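/- arXiv:2112.13441 — 4 statements merged into one kernel-verified Lean document; each statement's English description precedes it below -/
import Mathlib

section
/- Let F be a field, let r, s, n be positive integers with r + s = n, let A be an r × n matrix over F of rank r and B an s × n matrix over F of rank s, and suppose every row of A is orthogonal to every row of B (i.e. A · Bᵀ = 0). If the submatrix formed by the last s columns of B has rank s, then the submatrix formed by the first r columns of A has rank r. -/
/-- A square matrix of full rank over a field is invertible. -/
theorem Matrix.isUnit_of_rank_eq_card {F m : Type*} [Field F] [Fintype m] [DecidableEq m]
    {M : Matrix m m F} (h : M.rank = Fintype.card m) : IsUnit M := by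
  rw [← linearIndependent_rows_iff_isUnit, linearIndependent_iff_card_eq_finrank_span, ← h,
    M.rank_eq_finrank_span_row]
  rfl

/-- **Vojta's Lemma 2.19.** Let `A` be an `r × n` matrix of rank `r` and `B` an `s × n`
matrix of rank `s` over a field `F`, with `r + s = n`, such that every row of `A` is
orthogonal to every row of `B` (i.e. `A * Bᵀ = 0`). If the last `s` columns of `B`
have rank `s`, then the first `r` columns of `A` have rank `r`. -/
theorem vojta_lemma {F : Type*} [Field F] {r s n : ℕ} (hr : 0 < r) (hs : 0 < s)
    (hn : r + s = n)
    (A : Matrix (Fin r) (Fin n) F) (B : Matrix (Fin s) (Fin n) F)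
    (hA : A.rank = r) (hB : B.rank = s)
    (horth : A * B.transpose = 0)
    (hlast : (B.submatrix id fun j : Fin s => Fin.cast hn (Fin.natAdd r j)).rank = s) :
    (A.submatrix id fun i : Fin r => Fin.cast hn (Fin.castAdd s i)).rank = r := by
  subst hn
  simp only [Fin.cast_eq_self] at hlast ⊢
  set A₁ := A.submatrix id fun i : Fin r => Fin.castAdd s i
  set A₂ := A.submatrix id fun j : Fin s => Fin.natAdd r j
  set B₁ := B.submatrix id fun i : Fin r => Fin.castAdd s i
  set B₂ := B.submatrix id fun j : Fin s => Fin.natAdd r j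
  have hsum : A₁ * B₁.transpose + A₂ * B₂.transpose = 0 := by
    rw [← horth]
    ext i j
    simp [A₁, A₂, B₁, B₂, Matrix.mul_apply, Fin.sum_univ_add]
  have hunit : IsUnit B₂.transpose.det := by
    rw [Matrix.det_transpose, ← Matrix.isUnit_iff_isUnit_det]
    exact Matrix.isUnit_of_rank_eq_card (by simpa using hlast)
  have hA₂_eq : A₂ = A₁ * -(B₁.transpose * B₂.transpose⁻¹) := by
    rw [← Matrix.mul_nonsing_inv_cancel_right B₂.transpose A₂ hunit,
      eq_neg_of_add_eq_zero_right hsum, Matrix.mul_neg, Matrix.neg_mul, Matrix.mul_assoc]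
  have hfactor : A = A₁ * (Matrix.fromCols 1 (-(B₁.transpose * B₂.transpose⁻¹))).submatrix id
      finSumFinEquiv.symm := by
    ext i j
    refine Fin.addCases (fun k => ?_) (fun k => ?_) j
    · simp [Matrix.mul_apply, Matrix.one_apply, A₁]
    · simpa [Matrix.mul_apply, A₂] using congrFun (congrFun hA₂_eq i) k
  refine le_antisymm A₁.rank_le_height ?_
  calc r = A.rank := hA.symm
    _ ≤ A₁.rank := by
      conv_lhs => rw [hfactor]
      exact Matrix.rank_mul_le_left _ _
end

section
/- Let F be a field, let n ≥ 8, let A be an (n−4) × n matrix over F of rank n−4 and B a 4 × n matrix over F of rank 4 with A · Bᵀ = 0. Suppose that every set of 4 distinct columns of B is linearly independent over F. Then for every set J of n−4 column indices, the (n−4) × (n−4) submatrix of A formed by the columns indexed by J is invertible (has rank n−4). -/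
namespace Matrix

theorem linearIndependent_row_of_rank_eq_card {m n F : Type*} [Field F] [Fintype m] [Fintype n]
    {A : Matrix m n F} (hA : A.rank = Fintype.card m) : LinearIndependent F A.row := by
  rw [linearIndependent_iff_card_eq_finrank_span, ← hA, A.rank_eq_finrank_span_row]
  rfl

/-- If `A * Bᵀ = 0`, the rows of `A` are linearly independent, and the columns of `B` outside `J`
are linearly independent, then the rows of `A` restricted to `J` are linearly independent. -/
theorem linearIndependent_row_submatrix_of_mul_transpose_eq_zero {m k n F : Type*} [Field F]
    [Fintype m] [Fintype n] [DecidableEq n] {A : Matrix m n F} {B : Matrix k n F}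
    (hA : LinearIndependent F A.row) (horth : A * Bᵀ = 0) (J : Finset n)
    (hB : LinearIndependent F fun j : (Jᶜ : Finset n) => B.col j) :
    LinearIndependent F (A.submatrix id fun j : J => (j : n)).row := by
  rw [← vecMul_injective_iff] at hA ⊢
  rw [← coe_vecMulLinear, ← LinearMap.ker_eq_bot, LinearMap.ker_eq_bot'] at hA ⊢
  intro v hv
  refine hA v ?_
  have hJ : ∀ j ∈ J, (v ᵥ* A) j = 0 := fun j hj => congrFun hv ⟨j, hj⟩
  have hsum : ∑ j : (Jᶜ : Finset n), (v ᵥ* A) j • B.col j = 0 := by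
    rw [Finset.sum_coe_sort Jᶜ fun j => (v ᵥ* A) j • B.col j,
      Finset.sum_subset (Finset.subset_univ _)]
    · have h : (v ᵥ* A) ᵥ* Bᵀ = 0 := by rw [vecMul_vecMul, horth, vecMul_zero]
      rw [← h, vecMul_eq_sum (v ᵥ* A)]
      rfl
    · intro j _ hj
      rw [hJ j (by simpa using hj), zero_smul]
  have hcompl := Fintype.linearIndependent_iff.mp hB (fun j => (v ᵥ* A) j) hsum
  ext j
  by_cases hj : j ∈ J
  · exact hJ j hj
  · exact hcompl ⟨j, Finset.mem_compl.mpr hj⟩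

end Matrix


/-- Let `A` be an `(n-4) × n` matrix of rank `n-4` and `B` a `4 × n` matrix of rank `4`
over a field `F`, with `n ≥ 8` and `A * Bᵀ = 0`. If every `4` distinct columns of `B`
are linearly independent, then for every set `J` of `n-4` column indices, the square
submatrix of `A` on the columns indexed by `J` is invertible (has rank `n-4`). -/
theorem submatrix_invertible_of_four_columns_independent
    {F : Type*} [Field F] {n : ℕ} (hn : 8 ≤ n)
    (A : Matrix (Fin (n - 4)) (Fin n) F) (B : Matrix (Fin 4) (Fin n) F)
    (hA : A.rank = n - 4) (hB : B.rank = 4)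
    (horth : A * B.transpose = 0)
    (hBcols : ∀ c : Fin 4 → Fin n, Function.Injective c →
      LinearIndependent F fun i => B.transpose (c i)) :
    ∀ J : Finset (Fin n), J.card = n - 4 →
      (A.submatrix id fun j : J => (j : Fin n)).rank = n - 4 ∧
      ∀ e : Fin (n - 4) ≃ J, IsUnit (A.submatrix id fun i => ((e i : J) : Fin n)) := by
  intro J hJ
  have hcard : Fintype.card (Jᶜ : Finset (Fin n)) = 4 := by
    rw [Fintype.card_coe, Finset.card_compl, Fintype.card_fin]
    omega
  have hcompl : LinearIndependent F fun j : (Jᶜ : Finset (Fin n)) => B.col j := by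
    let f := Fintype.equivFinOfCardEq hcard
    rw [← linearIndependent_equiv f.symm]
    exact hBcols (fun i => f.symm i) (Subtype.val_injective.comp f.symm.injective)
  have hrow := Matrix.linearIndependent_row_submatrix_of_mul_transpose_eq_zero
    (Matrix.linearIndependent_row_of_rank_eq_card (by rw [hA, Fintype.card_fin])) horth J hcompl
  refine ⟨by rw [hrow.rank_matrix, Fintype.card_fin], fun e => ?_⟩
  rw [← Matrix.linearIndependent_rows_iff_isUnit]
  exact hrow.map' (LinearEquiv.funCongrLeft F F e).toLinearMap (LinearEquiv.ker _)
end

section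
/- Let K be a number field, let α₁, …, α_k ∈ K be nonzero elements such that the ratios αᵢ/αⱼ (1 ≤ i, j ≤ k) generate K as a field over ℚ. Then for any two distinct field embeddings σ, τ : K → ℂ, the vectors (σ(α₁), …, σ(α_k)) and (τ(α₁), …, τ(α_k)) in ℂ^k are linearly independent over ℂ. -/
/-- Two ring homomorphisms out of a field generated over `ℚ` by a set `S` agree as soon as they
agree on `S`. -/
theorem ringHom_eq_of_eqOn_adjoin_rat_eq_top {K L : Type*} [Field K] [CharZero K] [Field L]
    [CharZero L] {S : Set K} (hS : IntermediateField.adjoin ℚ S = ⊤) {σ τ : K →+* L}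
    (h : Set.EqOn σ τ S) : σ = τ := by
  have hle : IntermediateField.adjoin ℚ S ≤
      (AlgHom.equalizer σ.toRatAlgHom τ.toRatAlgHom).toIntermediateField
        (fun x hx => (map_inv₀ σ x).trans ((congrArg _ hx).trans (map_inv₀ τ x).symm)) :=
    IntermediateField.adjoin_le_iff.mpr h
  ext x
  exact hle (hS ▸ IntermediateField.mem_top : x ∈ IntermediateField.adjoin ℚ S)


/-- Let `K` be a number field and `α₁, …, α_k ∈ K` nonzero elements whose ratios
`αᵢ/αⱼ` generate `K` over `ℚ`. Then for any two distinct field embeddings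
`σ, τ : K → ℂ`, the vectors `(σ(α₁), …, σ(α_k))` and `(τ(α₁), …, τ(α_k))` in `ℂ^k`
are linearly independent over `ℂ`. -/
theorem embeddings_of_generating_ratios_independent
    {K : Type*} [Field K] [NumberField K] {k : ℕ}
    (α : Fin k → K) (hα : ∀ i, α i ≠ 0)
    (hgen : IntermediateField.adjoin ℚ {x : K | ∃ i j, x = α i / α j} = ⊤)
    (σ τ : K →+* ℂ) (hστ : σ ≠ τ) :
    LinearIndependent ℂ ![fun i => σ (α i), fun i => τ (α i)] := by
  have eq_of_cross (h : ∀ i j, σ (α i) * τ (α j) = τ (α i) * σ (α j)) : σ = τ := by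
    refine ringHom_eq_of_eqOn_adjoin_rat_eq_top hgen ?_
    rintro _ ⟨i, j, rfl⟩
    rw [map_div₀, map_div₀, div_eq_div_iff ((map_ne_zero σ).mpr (hα j))
      ((map_ne_zero τ).mpr (hα j)), h]
  refine LinearIndependent.pair_iff.mpr fun s t hst => ?_
  have hrel (i : Fin k) : s * σ (α i) + t * τ (α i) = 0 := congrFun hst i
  constructor <;> by_contra hne <;>
    refine hστ (eq_of_cross fun i j => mul_left_cancel₀ hne ?_)
  · linear_combination τ (α j) * hrel i - τ (α i) * hrel j
  · linear_combination σ (α i) * hrel j - σ (α j) * hrel i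
end

section
/- Let K be a totally complex number field (not necessarily Galois), let α₁, α₂, α₃ ∈ K be ℚ-linearly independent elements such that the ratios αⱼ/α_k generate K over ℚ, and let m be a nonzero integer. Then there exist a real constant C and a finite set S of triples (σ, τ, γ), where σ, τ are distinct field embeddings of K into ℂ and γ ∈ ℂ is nonzero, such that every solution (x₁, x₂, x₃) ∈ ℤ³ of N_{K/ℚ}(x₁α₁ + x₂α₂ + x₃α₃) = m with max{|x₁|, |x₂|, |x₃|} > C satisfies σ(u) = γ·τ(u) for some (σ, τ, γ) ∈ S, where u = x₁α₁ + x₂α₂ + x₃α₃. -/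
open NumberField

section

open Finset Polynomial

theorem exists_prod_sub_mul_eq (k : ℕ) (M : ℕ) (L : ℤ)
    (hL : ∀ z : ℤ, z ≠ 0 → z.natAbs ≤ M → z ∣ L) (N : ℕ) :
    ∀ x : ℤ, (∀ i ≤ N, x - k * i ≠ 0 ∧ (x - k * i).natAbs ≤ M) →
      ∃ z : ℤ, (∏ i ∈ range (N + 1), (x - k * i)) * z = N.factorial * k ^ N * L ∧
        |z| ≤ 2 ^ N * |L| := by
  induction N with
  | zero =>
    intro x hx
    obtain ⟨h0, h1⟩ := hx 0 le_rfl
    obtain ⟨z, hz⟩ := hL _ h0 h1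
    refine ⟨z, by simpa using hz.symm, ?_⟩
    rw [hz, abs_mul, pow_zero, one_mul]
    exact le_mul_of_one_le_left (abs_nonneg _) (Int.one_le_abs h0)
  | succ N ih =>
    intro x hx
    obtain ⟨z, hz, hzb⟩ := ih x fun i hi => hx i (by omega)
    obtain ⟨z', hz', hzb'⟩ := ih (x - k) fun i hi => by
      have := hx (i + 1) (by omega)
      push_cast at this
      rwa [show x - k - k * (i : ℤ) = x - k * (i + 1) by ring]
    refine ⟨z' - z, ?_, ?_⟩
    · have e1 : ∏ i ∈ range (N + 1), (x - k - k * (i : ℤ)) =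
          (∏ i ∈ range N, (x - k * ((i + 1 : ℕ) : ℤ))) * (x - k * ((N + 1 : ℕ) : ℤ)) := by
        rw [prod_range_succ]
        congr 1
        · exact prod_congr rfl fun i _ => by push_cast; ring
        · push_cast; ring
      rw [e1] at hz'
      rw [prod_range_succ'] at hz
      rw [prod_range_succ', prod_range_succ, Nat.factorial_succ, pow_succ]
      push_cast at *
      linear_combination x * hz' - (x - k * (N + 1)) * hz
    · calc |z' - z| ≤ |z'| + |z| := abs_sub _ _
        _ ≤ 2 ^ (N + 1) * |L| := by rw [pow_succ]; linarith

theorem exists_prod_ite_mul_eq (k n m : ℕ) :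
    ∃ z : ℤ, (∏ i ∈ range (n + m + 1), if i = n then 1 else (k * n - k * i : ℤ)) * z =
      (n + m).factorial * k ^ (n + m) ∧ |z| ≤ 2 ^ (n + m) := by
  have key : (∏ i ∈ range (n + m + 1), if i = n then 1 else (k * n - k * i : ℤ)) =
      n.factorial * k ^ n * ((-1) ^ m * m.factorial * k ^ m) := by
    induction m with
    | zero =>
      rw [add_zero, prod_range_succ, if_pos rfl, ← prod_range_reflect]
      have : ∏ j ∈ range n, (if n - 1 - j = n then 1 else (k * n - k * ((n - 1 - j : ℕ) : ℤ))) =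
          ∏ j ∈ range n, (((j + 1 : ℕ) : ℤ) * k) := by
        refine prod_congr rfl fun j hj => ?_
        have hj := mem_range.1 hj
        rw [if_neg (by omega), Nat.cast_sub (by omega), Nat.cast_sub (by omega)]
        push_cast; ring
      rw [this, prod_mul_distrib, ← Nat.cast_prod, prod_range_add_one_eq_factorial]
      simp
    | succ m ih =>
      rw [← add_assoc, prod_range_succ, ih, if_neg (by omega), Nat.factorial_succ]
      push_cast; ring
  refine ⟨(-1) ^ m * (n + m).choose m, ?_, ?_⟩
  · have h := Nat.choose_mul_factorial_mul_factorial (Nat.le_add_left m n)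
    rw [Nat.add_sub_cancel] at h
    have h' : (((n + m).choose m * m.factorial * n.factorial : ℕ) : ℤ) = (n + m).factorial := by
      rw [h]
    push_cast at h'
    have h1 : ((-1 : ℤ) ^ m) * (-1) ^ m = 1 := by rw [← mul_pow]; simp
    rw [key, ← h', pow_add]
    linear_combination (((n + m).choose m : ℤ) * m.factorial * n.factorial * k ^ n * k ^ m) * h1
  · rw [abs_mul, abs_pow, abs_neg, abs_one, one_pow, one_mul, Nat.abs_cast]
    exact_mod_cast Nat.choose_le_two_pow _ _

/-- The integers `k * n + j` with `n < N` and `j ≤ d`. -/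
def gridSet (k d N : ℕ) : Finset ℕ :=
  (range N ×ˢ range (d + 1)).image fun p => k * p.1 + p.2

theorem gridSet_injOn {k d : ℕ} (hd : d < k) (N : ℕ) :
    Set.InjOn (fun p : ℕ × ℕ => k * p.1 + p.2) ((range N ×ˢ range (d + 1) : Finset (ℕ × ℕ))) := by
  rintro ⟨a, b⟩ h ⟨a', b'⟩ h' e
  simp only [coe_product, coe_range, Set.mem_prod, Set.mem_Iio] at h h' e
  have hb : b = b' := by
    have := congrArg (· % k) e
    simpa [Nat.mul_add_mod, Nat.mod_eq_of_lt (show b < k by omega),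
      Nat.mod_eq_of_lt (show b' < k by omega)] using this
  subst hb
  have : a = a' := Nat.eq_of_mul_eq_mul_left (show 0 < k by omega) (by omega)
  rw [this]

theorem card_gridSet {k d : ℕ} (hd : d < k) (N : ℕ) : (gridSet k d N).card = N * (d + 1) := by
  rw [gridSet, card_image_of_injOn (gridSet_injOn hd N), card_product, card_range, card_range]

theorem mem_gridSet {k d N l : ℕ} : l ∈ gridSet k d N ↔ ∃ n < N, ∃ j ≤ d, k * n + j = l := by
  simp [gridSet, and_assoc]

theorem lt_of_mem_gridSet {k d N l : ℕ} (hd : d < k) (h : l ∈ gridSet k d N) : l < k * N := by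
  obtain ⟨n, hn, j, hj, rfl⟩ := mem_gridSet.1 h
  calc k * n + j < k * n + k := by omega
    _ = k * (n + 1) := by ring
    _ ≤ k * N := Nat.mul_le_mul_left _ hn

theorem gridSet_mono (k d : ℕ) {N N' : ℕ} (h : N ≤ N') : gridSet k d N ⊆ gridSet k d N' := by
  intro l hl
  obtain ⟨n, hn, j, hj, e⟩ := mem_gridSet.1 hl
  exact mem_gridSet.2 ⟨n, hn.trans_le h, j, hj, e⟩

theorem exists_prod_erase_gridSet_mul_eq {k d : ℕ} (hd : d < k) (N : ℕ) {l : ℕ}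
    (hl : l ∈ gridSet k d (N + 1)) :
    ∃ z : ℤ, (∏ l' ∈ (gridSet k d (N + 1)).erase l, ((l : ℤ) - l')) * z =
        (N.factorial * k ^ N * Nat.lcmUpto (k * (N + 1))) ^ (d + 1) ∧
      |z| ≤ (2 ^ N * Nat.lcmUpto (k * (N + 1))) ^ (d + 1) := by
  set L := Nat.lcmUpto (k * (N + 1)) with hLdef
  have hL : ∀ z : ℤ, z ≠ 0 → z.natAbs ≤ k * (N + 1) → z ∣ (L : ℤ) := by
    intro z hz hb
    rw [← Int.natAbs_dvd, Int.natCast_dvd_natCast]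
    have : id z.natAbs ∣ L := dvd_lcm (mem_Icc.2 ⟨Int.natAbs_pos.2 hz, hb⟩)
    exact this
  have hL0 : 0 < L := Nat.lcmUpto_pos _
  obtain ⟨n, hn, j, hj, rfl⟩ := mem_gridSet.1 hl
  have hcol : ∀ j' ∈ range (d + 1), ∃ z : ℤ,
      (∏ i ∈ range (N + 1), if k * i + j' = k * n + j then (1 : ℤ)
        else ((k * n + j : ℕ) : ℤ) - (k * i + j' : ℕ)) * z = N.factorial * k ^ N * L ∧
      |z| ≤ 2 ^ N * L := by
    intro j' hj'
    have hj' := mem_range.1 hj'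
    by_cases hjj : j' = j
    · subst hjj
      obtain ⟨m, rfl⟩ : ∃ m, N = n + m := ⟨N - n, by omega⟩
      obtain ⟨z, hz, hzb⟩ := exists_prod_ite_mul_eq k n m
      refine ⟨z * L, ?_, ?_⟩
      · rw [← mul_assoc, ← hz]
        congr 2
        refine prod_congr rfl fun i _ => ?_
        have : k * i + j' = k * n + j' ↔ i = n := by
          rw [Nat.add_right_cancel_iff]
          exact Nat.mul_right_inj (by omega)
        simp only [this]
        split_ifs
        · rfl
        · push_cast; ring
      · rw [abs_mul, Nat.abs_cast]
        gcongr
    · have hne : ∀ i, k * i + j' ≠ k * n + j := by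
        intro i e
        have := congrArg (· % k) e
        simp [Nat.mod_eq_of_lt (show j < k by omega),
          Nat.mod_eq_of_lt (show j' < k by omega)] at this
        exact hjj this
      obtain ⟨z, hz, hzb⟩ := exists_prod_sub_mul_eq k (k * (N + 1)) L hL N
        (((k * n + j : ℕ) : ℤ) - j') fun i hi => by
          have h1 : k * i ≤ k * N := Nat.mul_le_mul_left _ hi
          have h2 : k * n ≤ k * N := Nat.mul_le_mul_left _ (by omega)
          have h3 : k * (N + 1) = k * N + k := by ring
          have := hne i
          rw [h3]
          zify at *
          constructor
          · intro h; apply this; linarith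
          · rw [abs_le]
            have : (0 : ℤ) ≤ k * n := by positivity
            have : (0 : ℤ) ≤ k * i := by positivity
            constructor <;> linarith
      refine ⟨z, ?_, by simpa using hzb⟩
      rw [← hz]
      congr 1
      refine prod_congr rfl fun i _ => ?_
      rw [if_neg (hne i)]
      push_cast; ring
  choose! z hz hzb using hcol
  refine ⟨∏ j' ∈ range (d + 1), z j', ?_, ?_⟩
  · have e : ∏ l' ∈ (gridSet k d (N + 1)).erase (k * n + j), (((k * n + j : ℕ) : ℤ) - l') =
        ∏ l' ∈ gridSet k d (N + 1), if l' = k * n + j then (1 : ℤ)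
          else ((k * n + j : ℕ) : ℤ) - l' := by
      rw [← mul_prod_erase _ _ hl, if_pos rfl, one_mul]
      exact prod_congr rfl fun l' hl' => by rw [if_neg (ne_of_mem_erase hl')]
    rw [e, gridSet, prod_image (gridSet_injOn hd _), prod_product_right, ← prod_mul_distrib,
      prod_congr rfl hz, prod_const, card_range]
  · rw [abs_prod]
    calc ∏ j' ∈ range (d + 1), |z j'| ≤ ∏ j' ∈ range (d + 1), (2 ^ N * L : ℤ) :=
          prod_le_prod (fun _ _ => abs_nonneg _) hzb
      _ = _ := by rw [prod_const, card_range]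

theorem sum_choose_div_prod_eq_zero (s : Finset ℕ) {m : ℕ} (hm : m + 1 < s.card) :
    ∑ l ∈ s, (l.choose m : ℚ) / ∏ l' ∈ s.erase l, ((l : ℚ) - l') = 0 := by
  have h := Lagrange.coeff_eq_sum (s := s) (v := fun l : ℕ => (l : ℚ))
    (P := descPochhammer ℚ m) (fun a _ b _ h => Nat.cast_injective h) (by
      rw [degree_eq_natDegree (monic_descPochhammer ℚ m).ne_zero, descPochhammer_natDegree]
      exact_mod_cast (by omega))
  rw [coeff_eq_zero_of_natDegree_lt (by rw [descPochhammer_natDegree]; omega)] at h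
  have hf : (m.factorial : ℚ) ≠ 0 := by exact_mod_cast m.factorial_ne_zero
  apply mul_left_cancel₀ hf
  rw [mul_zero, mul_sum, h]
  refine sum_congr rfl fun l _ => ?_
  rw [descPochhammer_eval_eq_descFactorial, Nat.descFactorial_eq_factorial_mul_choose]
  push_cast; ring

theorem lcmUpto_le_pow (n : ℕ) : Nat.lcmUpto n ≤ ⌈Real.exp (Real.log 4 + 4)⌉₊ ^ n := by
  have h := Chebyshev.psi_le_const_mul_self (Nat.cast_nonneg (α := ℝ) n)
  rw [Chebyshev.psi_eq_log_lcmUpto,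
    Real.log_le_iff_le_exp (by exact_mod_cast Nat.lcmUpto_pos n)] at h
  have : (Nat.lcmUpto n : ℝ) ≤ (⌈Real.exp (Real.log 4 + 4)⌉₊ : ℝ) ^ n := by
    refine h.trans ?_
    rw [mul_comm, Real.exp_nat_mul]
    gcongr
    exact Nat.le_ceil _
  exact_mod_cast this

/-- Integral Hermite-Padé coefficients for the functions `y ^ j`, `j ≤ d`, over `ℚ[y ^ k]`
at `y = 1`, of exponential size. -/
theorem exists_hermitePade_coeff {k d : ℕ} (hd : d < k) :
    ∃ C : ℕ, ∀ N, ∀ i ≤ d, ∃ c : ℕ → ℤ, (∀ l, |c l| ≤ C ^ (N + 1)) ∧ c (k * N + i) ≠ 0 ∧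
      (∀ l, l ∉ insert (k * N + i) (gridSet k d N) → c l = 0) ∧
      ∀ m < N * (d + 1), ∑ l ∈ gridSet k d (N + 1), c l * (l.choose m : ℤ) = 0 := by
  set B := ⌈Real.exp (Real.log 4 + 4)⌉₊ with hB
  refine ⟨(2 * B ^ k * (2 * k)) ^ (d + 1), fun N i hi => ?_⟩
  set s := insert (k * N + i) (gridSet k d N) with hs
  set t := gridSet k d (N + 1) with ht
  have htop : k * N + i ∈ t := mem_gridSet.2 ⟨N, by omega, i, hi, rfl⟩
  have hst : s ⊆ t := insert_subset htop (gridSet_mono k d (by omega))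
  have htop' : k * N + i ∉ gridSet k d N := fun h => by
    have := lt_of_mem_gridSet hd h
    omega
  have hscard : s.card = N * (d + 1) + 1 := by rw [hs, card_insert_of_notMem htop', card_gridSet hd]
  have htcard : (t \ s).card = d := by
    rw [card_sdiff_of_subset hst, hscard, ht, card_gridSet hd]
    have : (N + 1) * (d + 1) = N * (d + 1) + d + 1 := by ring
    omega
  set L := Nat.lcmUpto (k * (N + 1)) with hL
  set Q : ℤ := (N.factorial * k ^ N * L) ^ (d + 1) with hQ
  have hQ0 : Q ≠ 0 := by
    have h1 : N.factorial ≠ 0 := N.factorial_ne_zero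
    have h2 : k ≠ 0 := by omega
    have h3 : L ≠ 0 := Nat.lcmUpto_ne_zero _
    positivity
  have hz : ∀ l ∈ t, ∃ z : ℤ, (∏ l' ∈ t.erase l, ((l : ℤ) - l')) * z = Q ∧
      |z| ≤ (2 ^ N * L) ^ (d + 1) := fun l hl => exists_prod_erase_gridSet_mul_eq hd N hl
  choose! z hz hzb using hz
  have hprod : ∀ l ∈ s, (∏ l' ∈ s.erase l, ((l : ℤ) - l')) *
      (z l * ∏ l' ∈ t \ s, ((l : ℤ) - l')) = Q := by
    intro l hl
    rw [← hz l (hst hl), ← prod_sdiff (erase_subset_erase l hst)]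
    have : t.erase l \ s.erase l = t \ s := by
      ext x
      simp only [mem_sdiff, mem_erase]
      constructor
      · rintro ⟨⟨h1, h2⟩, h3⟩
        exact ⟨h2, fun h => h3 ⟨h1, h⟩⟩
      · rintro ⟨h1, h2⟩
        exact ⟨⟨fun e => h2 (e ▸ hl), h1⟩, fun h => h2 h.2⟩
    rw [this]
    ring
  refine ⟨fun l => if l ∈ s then z l * ∏ l' ∈ t \ s, ((l : ℤ) - l') else 0, fun l => ?_, ?_,
    fun l hl => if_neg hl, fun m hm => ?_⟩
  · dsimp only
    split_ifs with hl
    · have hLB : L ≤ B ^ (k * (N + 1)) := lcmUpto_le_pow _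
      have h1 : |∏ l' ∈ t \ s, ((l : ℤ) - l')| ≤ (k * (N + 1)) ^ (d + 1) := by
        rw [abs_prod]
        calc ∏ l' ∈ t \ s, |(l : ℤ) - l'| ≤ ∏ l' ∈ t \ s, (k * (N + 1) : ℤ) := by
              refine prod_le_prod (fun _ _ => abs_nonneg _) fun l' hl' => ?_
              have h1 := lt_of_mem_gridSet hd (hst hl)
              have h2 := lt_of_mem_gridSet hd (mem_sdiff.1 hl').1
              zify at h1 h2
              rw [abs_le]
              constructor <;> linarith
          _ = (k * (N + 1)) ^ d := by rw [prod_const, htcard]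
          _ ≤ _ := by
              gcongr
              · have : (1 : ℤ) ≤ k := by exact_mod_cast (by omega : 1 ≤ k)
                nlinarith
              · omega
      rw [abs_mul]
      calc |z l| * |∏ l' ∈ t \ s, ((l : ℤ) - l')|
          ≤ (2 ^ N * L) ^ (d + 1) * (k * (N + 1)) ^ (d + 1) := by
            gcongr
            exact hzb l (hst hl)
        _ = (2 ^ N * L * (k * (N + 1))) ^ (d + 1) := by rw [mul_pow _ ((k : ℤ) * _)]
        _ ≤ (2 ^ (N + 1) * (B ^ k) ^ (N + 1) * (k ^ (N + 1) * 2 ^ (N + 1))) ^ (d + 1) := by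
            have a1 : (L : ℤ) ≤ (B ^ k) ^ (N + 1) := by
              rw [← pow_mul]
              exact_mod_cast hLB
            have a2 : (N + 1 : ℤ) ≤ 2 ^ (N + 1) := by
              exact_mod_cast Nat.lt_two_pow_self.le
            have a3 : (k : ℤ) ≤ k ^ (N + 1) :=
              le_self_pow₀ (by exact_mod_cast (by omega : 1 ≤ k)) (by omega)
            gcongr
            · norm_num
            · omega
        _ = _ := by
            push_cast
            rw [pow_right_comm _ (d + 1)]
            congr 1
            rw [mul_pow, mul_pow, mul_pow]
            ring
    · rw [abs_zero]
      positivity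
  · have hm : k * N + i ∈ s := mem_insert_self _ _
    simp only [if_pos hm]
    exact fun h => hQ0 (by rw [← hprod _ hm, h, mul_zero])
  · have h := sum_choose_div_prod_eq_zero s (m := m) (by omega)
    have : ∑ l ∈ t, (if l ∈ s then z l * ∏ l' ∈ t \ s, ((l : ℤ) - l') else 0) * (l.choose m : ℤ) =
        ∑ l ∈ s, (z l * ∏ l' ∈ t \ s, ((l : ℤ) - l')) * (l.choose m : ℤ) := by
      symm
      refine (sum_congr rfl fun l hl => by rw [if_pos hl]).trans
        (sum_subset hst fun l _ hl => by rw [if_neg hl, zero_mul])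
    rw [this]
    have h' : ∑ l ∈ s, (((z l * ∏ l' ∈ t \ s, ((l : ℤ) - l')) * (l.choose m : ℤ) : ℤ) : ℚ) =
        Q * ∑ l ∈ s, (l.choose m : ℚ) / ∏ l' ∈ s.erase l, ((l : ℚ) - l') := by
      rw [mul_sum]
      refine sum_congr rfl fun l hl => ?_
      have hp : (∏ l' ∈ s.erase l, ((l : ℚ) - l')) ≠ 0 :=
        prod_ne_zero_iff.2 fun l' hl' => sub_ne_zero.2 fun e =>
          ne_of_mem_erase hl' (Nat.cast_injective e).symm
      have hQ' := congrArg (Int.cast : ℤ → ℚ) (hprod l hl)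
      push_cast at hQ' ⊢
      rw [← hQ']
      field_simp
    rw [h, mul_zero] at h'
    exact_mod_cast h'

theorem sum_gridSet {k d : ℕ} (hd : d < k) (N : ℕ) {R : Type*} [AddCommMonoid R] (f : ℕ → R) :
    ∑ l ∈ gridSet k d N, f l = ∑ n ∈ range N, ∑ j ∈ range (d + 1), f (k * n + j) := by
  rw [gridSet, sum_image (gridSet_injOn hd N), sum_product]

theorem pow_eq_sum_choose_mul_sub_one_pow {R : Type*} [CommRing R] (y : R) {l T : ℕ} (h : l < T) :
    y ^ l = ∑ m ∈ range T, (l.choose m : R) * (y - 1) ^ m := by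
  conv_lhs => rw [← sub_add_cancel y 1, add_pow]
  have hsub : range (l + 1) ⊆ range T := range_subset_range.2 h
  rw [← sum_subset hsub fun m _ hm => by
    rw [Nat.choose_eq_zero_of_lt (by simpa using hm), Nat.cast_zero, zero_mul]]
  exact sum_congr rfl fun m _ => by rw [one_pow, mul_one, mul_comm]

theorem X_sub_one_pow_dvd_sum {R : Type*} [CommRing R] (s : Finset ℕ) (c : ℕ → R) (M : ℕ)
    (h : ∀ m < M, ∑ l ∈ s, c l * (l.choose m : R) = 0) :
    (X - 1) ^ M ∣ ∑ l ∈ s, C (c l) * X ^ l := by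
  have : ∑ l ∈ s, C (c l) * X ^ l =
      ∑ m ∈ range (s.sup id + 1), C (∑ l ∈ s, c l * (l.choose m : R)) * (X - 1) ^ m := by
    simp only [map_sum, sum_mul]
    rw [sum_comm]
    refine sum_congr rfl fun l hl => ?_
    rw [pow_eq_sum_choose_mul_sub_one_pow (X : R[X])
      (Nat.lt_succ_of_le (show l ≤ s.sup id from le_sup (f := id) hl)), mul_sum]
    refine sum_congr rfl fun m _ => ?_
    rw [C_mul, map_natCast, mul_assoc]
  rw [this]
  refine dvd_sum fun m _ => ?_
  rcases lt_or_ge m M with hm | hm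
  · simp [h m hm]
  · exact (pow_dvd_pow _ hm).mul_left _

theorem eq_zero_of_X_sub_one_pow_dvd {R : Type*} [Field R] [CharZero R] (T : ℕ) :
    ∀ p : R[X], p.support.card ≤ T → (X - 1) ^ T ∣ p → p = 0 := by
  induction T with
  | zero =>
    intro p hp _
    exact support_eq_empty.1 (card_eq_zero.1 (by omega))
  | succ T ih =>
    intro p hp hdvd
    by_contra hp0
    obtain ⟨a, ha⟩ := nonempty_support_iff.2 hp0
    set q : R[X] := X * derivative p - C (a : R) * p with hq
    have hqc : ∀ n, q.coeff n = ((n : R) - a) * p.coeff n := by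
      intro n
      rw [hq, coeff_sub, coeff_C_mul]
      cases n with
      | zero => simp
      | succ n => rw [coeff_X_mul, coeff_derivative]; push_cast; ring
    have hq0 : q = 0 := by
      apply ih
      · have : q.support ⊆ p.support.erase a := by
          intro n hn
          rw [mem_support_iff, hqc] at hn
          refine mem_erase.2 ⟨fun e => hn (by rw [e, sub_self, zero_mul]), ?_⟩
          exact mem_support_iff.2 (right_ne_zero_of_mul hn)
        have h := card_le_card this
        rw [card_erase_of_mem ha] at h
        omega
      · obtain ⟨r, rfl⟩ := hdvd
        rw [hq, derivative_mul, derivative_pow]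
        refine ⟨X * (C ((T + 1 : ℕ) : R) * r + (X - 1) * derivative r) - C (a : R) * ((X - 1) * r), ?_⟩
        simp only [derivative_sub, derivative_X, derivative_one, Nat.add_sub_cancel, map_natCast]
        ring
    have hp1 : p = C (p.coeff a) * X ^ a := by
      ext n
      rw [coeff_C_mul_X_pow]
      split_ifs with h
      · rw [h]
      · have h1 := hqc n
        rw [hq0, coeff_zero, eq_comm, mul_eq_zero, sub_eq_zero, Nat.cast_inj] at h1
        exact h1.resolve_left h
    have h1 : p.eval 1 = 0 := by
      obtain ⟨r, rfl⟩ := hdvd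
      simp
    rw [hp1] at h1
    simp only [eval_mul, eval_C, eval_pow, eval_X, one_pow, mul_one] at h1
    exact mem_support_iff.1 ha h1

theorem exists_sum_hermitePade_ne_zero {R : Type*} [Field R] [CharZero R] {k d : ℕ} (hd : d < k)
    (N : ℕ) (c : ℕ → ℕ → ℤ)
    (htop : ∀ i ≤ d, c i (k * N + i) ≠ 0)
    (hsupp : ∀ i ≤ d, ∀ l, l ∉ insert (k * N + i) (gridSet k d N) → c i l = 0)
    (hvan : ∀ i ≤ d, ∀ m < N * (d + 1),
      ∑ l ∈ gridSet k d (N + 1), c i l * (l.choose m : ℤ) = 0)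
    {x : R} (hx : x ≠ 1) (y : R) :
    ∃ i ≤ d, ∑ n ∈ range (N + 1), ∑ j ∈ range (d + 1), (c i (k * n + j) : R) * x ^ n * y ^ j ≠ 0 := by
  by_contra! hcon
  let A : Matrix (Fin (d + 1)) (Fin (d + 1)) R :=
    fun i j => ∑ n ∈ range (N + 1), (c i (k * n + j) : R) * x ^ n
  have hdet : A.det = 0 := by
    refine Matrix.exists_mulVec_eq_zero_iff.1 ⟨fun j => y ^ (j : ℕ), fun h => ?_, ?_⟩
    · simpa using congrFun h 0
    · ext i
      rw [Pi.zero_apply, ← hcon i (by omega), sum_comm, ← Fin.sum_univ_eq_sum_range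
        (fun j => ∑ n ∈ range (N + 1), (c i (k * n + j) : R) * x ^ n * y ^ j)]
      simp only [A, Matrix.mulVec, dotProduct, sum_mul]
  obtain ⟨b, hb0, hb⟩ := Matrix.exists_vecMul_eq_zero_iff.2 hdet
  let g : ℕ → R := fun l => ∑ i, b i * (c (i : ℕ) l : R)
  let P : ℕ → R[X] := fun j => ∑ n ∈ range (N + 1), C (g (k * n + j)) * X ^ n
  have hroot : ∀ j ≤ d, X - C x ∣ P j := by
    intro j hj
    rw [dvd_iff_isRoot, IsRoot]
    have h := congrFun hb ⟨j, by omega⟩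
    simp only [A, Matrix.vecMul, dotProduct, Pi.zero_apply, mul_sum] at h
    rw [sum_comm] at h
    simp only [P, g, eval_finsetSum, eval_mul, eval_C, eval_pow, eval_X, sum_mul]
    rw [← h]
    exact sum_congr rfl fun n _ => sum_congr rfl fun i _ => by ring
  have hroot' : ∀ j, ∃ r, j ≤ d → P j = (X - C x) * r := fun j => by
    by_cases hj : j ≤ d
    · obtain ⟨r, hr⟩ := hroot j hj
      exact ⟨r, fun _ => hr⟩
    · exact ⟨0, fun h => absurd h hj⟩
  choose r hr using hroot'
  have hrdeg : ∀ j ≤ d, ∀ n, N ≤ n → (r j).coeff n = 0 := by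
    intro j hj n hn
    by_contra h
    have hr0 : r j ≠ 0 := fun e => h (by rw [e, coeff_zero])
    have h1 : n ≤ (r j).natDegree := le_natDegree_of_ne_zero h
    have h2 : (P j).natDegree = 1 + (r j).natDegree := by
      rw [hr j hj, natDegree_mul (X_sub_C_ne_zero x) hr0, natDegree_X_sub_C]
    have h3 : (P j).natDegree ≤ N := by
      refine natDegree_sum_le_of_forall_le _ _ fun n hn => ?_
      exact (natDegree_C_mul_X_pow_le _ _).trans (by simp at hn; omega)
    omega
  let G : R[X] := ∑ l ∈ gridSet k d (N + 1), C (g l) * X ^ l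
  let H : R[X] := ∑ j ∈ range (d + 1), X ^ j * expand R k (r j)
  have hGH : G = (X ^ k - C x) * H := by
    simp only [G, H]
    rw [sum_gridSet hd, sum_comm, mul_sum]
    refine sum_congr rfl fun j hj => ?_
    have h := congrArg (expand R k) (hr j (by simp at hj; omega))
    simp only [P, map_sum, map_mul, map_sub, expand_C, map_pow, expand_X] at h
    rw [mul_left_comm, ← h, mul_sum]
    refine sum_congr rfl fun n _ => ?_
    rw [pow_add, pow_mul]
    ring
  have hdvdG : (X - 1) ^ (N * (d + 1)) ∣ G := by
    refine X_sub_one_pow_dvd_sum _ _ _ fun m hm => ?_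
    simp only [g, sum_mul]
    rw [sum_comm]
    refine sum_eq_zero fun i _ => ?_
    have h := congrArg (Int.cast : ℤ → R) (hvan i (by omega) m hm)
    push_cast at h
    simp only [mul_assoc]
    rw [← mul_sum, h, mul_zero]
  have hcop : IsCoprime ((X - 1 : R[X]) ^ (N * (d + 1))) (X ^ k - C x) := by
    apply IsCoprime.pow_left
    rw [← C_1, (irreducible_X_sub_C (1 : R)).coprime_iff_not_dvd, dvd_iff_isRoot]
    simpa [sub_eq_zero] using hx.symm
  have hH : H = 0 := by
    refine eq_zero_of_X_sub_one_pow_dvd (N * (d + 1)) H ?_ (hcop.dvd_of_dvd_mul_left (hGH ▸ hdvdG))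
    rw [← card_gridSet hd]
    refine card_le_card fun l hl => ?_
    rw [mem_support_iff, finsetSum_coeff] at hl
    obtain ⟨j, hj, hlj⟩ := exists_ne_zero_of_sum_ne_zero hl
    rw [coeff_X_pow_mul', coeff_expand (by omega)] at hlj
    have hjl : j ≤ l := by by_contra h; simp [h] at hlj
    rw [if_pos hjl] at hlj
    have hk : k ∣ l - j := by by_contra h; simp [h] at hlj
    rw [if_pos hk] at hlj
    simp only [mem_range] at hj
    refine mem_gridSet.2 ⟨(l - j) / k, ?_, j, by omega, ?_⟩
    · by_contra h
      exact hlj (hrdeg j (by omega) _ (by omega))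
    · rw [Nat.mul_div_cancel' hk]
      omega
  have hG : G = 0 := by rw [hGH, hH, mul_zero]
  apply hb0
  ext i
  have hi : (i : ℕ) ≤ d := by omega
  have h := congrArg (fun p => coeff p (k * N + i)) hG
  simp only [G, finsetSum_coeff, coeff_C_mul_X_pow, coeff_zero] at h
  rw [sum_ite_eq, if_pos (mem_gridSet.2 ⟨N, by omega, i, hi, rfl⟩)] at h
  simp only [g] at h
  rw [sum_eq_single i (fun i' _ hne => ?_) (by simp)] at h
  · exact (mul_eq_zero.1 h).resolve_right (by exact_mod_cast htop i hi)
  · rw [hsupp i' (by omega), Int.cast_zero, mul_zero]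
    rw [mem_insert, not_or]
    exact ⟨fun e => hne (Fin.ext (by omega)), fun e => by
      have := lt_of_mem_gridSet hd e
      omega⟩

theorem norm_sum_le_of_vanishing {k d : ℕ} (hd : d < k) (N : ℕ) (c : ℕ → ℤ) {B : ℝ}
    (hB : ∀ l, ‖(c l : ℂ)‖ ≤ B)
    (hvan : ∀ m < N * (d + 1), ∑ l ∈ gridSet k d (N + 1), c l * (l.choose m : ℤ) = 0)
    {y : ℂ} (hy : ‖y - 1‖ ≤ 1) :
    ‖∑ l ∈ gridSet k d (N + 1), (c l : ℂ) * y ^ l‖ ≤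
      (N + 1) * (d + 1) * B * 2 ^ (k * (N + 1)) * ‖y - 1‖ ^ (N * (d + 1)) := by
  set t := gridSet k d (N + 1) with ht
  have hB0 : 0 ≤ B := (norm_nonneg _).trans (hB 0)
  have e1 : ∑ l ∈ t, (c l : ℂ) * y ^ l =
      ∑ l ∈ t, ∑ m ∈ range (k * (N + 1)), (c l : ℂ) * ((l.choose m : ℂ) * (y - 1) ^ m) :=
    sum_congr rfl fun l hl => by
      rw [pow_eq_sum_choose_mul_sub_one_pow y (lt_of_mem_gridSet hd hl), mul_sum]
  have e2 : ∑ l ∈ t, (c l : ℂ) * y ^ l =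
      ∑ l ∈ t, ∑ m ∈ range (k * (N + 1)),
        if m < N * (d + 1) then 0 else (c l : ℂ) * ((l.choose m : ℂ) * (y - 1) ^ m) := by
    rw [e1, sum_comm, sum_comm (s := t)]
    refine sum_congr rfl fun m _ => ?_
    split_ifs with hm
    · have h := congrArg (Int.cast : ℤ → ℂ) (hvan m hm)
      push_cast at h
      simp only [← mul_assoc]
      rw [← sum_mul, h, zero_mul, sum_const_zero]
    · rfl
  rw [e2]
  have hl : ∀ l ∈ t, ‖∑ m ∈ range (k * (N + 1)),
        if m < N * (d + 1) then 0 else (c l : ℂ) * ((l.choose m : ℂ) * (y - 1) ^ m)‖ ≤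
        B * 2 ^ (k * (N + 1)) * ‖y - 1‖ ^ (N * (d + 1)) := by
    intro l hl
    have hlt := lt_of_mem_gridSet hd hl
    have h2 : ∑ m ∈ range (k * (N + 1)), (l.choose m : ℝ) = 2 ^ l := by
      have := pow_eq_sum_choose_mul_sub_one_pow (2 : ℝ) hlt
      norm_num at this
      exact this.symm
    calc _ ≤ ∑ m ∈ range (k * (N + 1)),
          B * ((l.choose m : ℝ) * ‖y - 1‖ ^ (N * (d + 1))) := by
          refine norm_sum_le_of_le _ fun m _ => ?_
          split_ifs with hm
          · rw [norm_zero]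
            positivity
          · rw [norm_mul, norm_mul, norm_pow, Complex.norm_natCast]
            exact mul_le_mul (hB l) (mul_le_mul_of_nonneg_left
              (pow_le_pow_of_le_one (norm_nonneg _) hy (not_lt.1 hm)) (Nat.cast_nonneg _))
              (by positivity) hB0
      _ = B * 2 ^ l * ‖y - 1‖ ^ (N * (d + 1)) := by
          rw [← mul_sum, ← sum_mul, h2, mul_assoc]
      _ ≤ _ := by
          gcongr
          norm_num
  refine (norm_sum_le_of_le _ hl).trans (le_of_eq ?_)
  rw [sum_const, ht, card_gridSet hd, nsmul_eq_mul]
  push_cast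
  ring

theorem norm_pow_sub_pow_le {x y : ℂ} (hx : ‖x‖ = 1) (hy : ‖y‖ = 1) (n : ℕ) :
    ‖x ^ n - y ^ n‖ ≤ n * ‖x - y‖ := by
  rw [← Commute.geom_sum₂_mul (Commute.all x y), norm_mul]
  gcongr
  refine (norm_sum_le_of_le (f := fun i => x ^ i * y ^ (n - 1 - i)) (n := fun _ => (1 : ℝ)) _
    fun i _ => ?_).trans (by simp)
  rw [norm_mul, norm_pow, norm_pow, hx, hy]
  simp

theorem norm_sum_le_of_vanishing_two {k d : ℕ} (hd : d < k) (N : ℕ) (c : ℕ → ℤ) {B : ℝ}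
    (hB : ∀ l, ‖(c l : ℂ)‖ ≤ B)
    (hvan : ∀ m < N * (d + 1), ∑ l ∈ gridSet k d (N + 1), c l * (l.choose m : ℤ) = 0)
    {y y' : ℂ} (hy : ‖y - 1‖ ≤ 1) (hy1 : ‖y‖ = 1) (hy1' : ‖y'‖ = 1) :
    ‖∑ n ∈ range (N + 1), ∑ j ∈ range (d + 1), (c (k * n + j) : ℂ) * (y ^ k) ^ n * y' ^ j‖ ≤
      (N + 1) * (d + 1) * B * 2 ^ (k * (N + 1)) *
        (‖y - 1‖ ^ (N * (d + 1)) + ‖y' - y‖) := by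
  have hB0 : 0 ≤ B := (norm_nonneg _).trans (hB 0)
  have h1 := norm_sum_le_of_vanishing hd N c hB hvan hy
  rw [sum_gridSet hd] at h1
  have e : ∑ n ∈ range (N + 1), ∑ j ∈ range (d + 1), (c (k * n + j) : ℂ) * (y ^ k) ^ n * y' ^ j =
      ∑ n ∈ range (N + 1), ∑ j ∈ range (d + 1), (c (k * n + j) : ℂ) * y ^ (k * n + j) +
      ∑ n ∈ range (N + 1), ∑ j ∈ range (d + 1),
        (c (k * n + j) : ℂ) * (y ^ k) ^ n * (y' ^ j - y ^ j) := by
    rw [← sum_add_distrib]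
    refine sum_congr rfl fun n _ => ?_
    rw [← sum_add_distrib]
    refine sum_congr rfl fun j _ => ?_
    rw [pow_add, pow_mul]
    ring
  have h2 : ‖∑ n ∈ range (N + 1), ∑ j ∈ range (d + 1),
        (c (k * n + j) : ℂ) * (y ^ k) ^ n * (y' ^ j - y ^ j)‖ ≤
      (N + 1) * (d + 1) * B * 2 ^ (k * (N + 1)) * ‖y' - y‖ := by
    have hdk : (d : ℝ) ≤ 2 ^ (k * (N + 1)) := by
      have h : d < 2 ^ (k * (N + 1)) := Nat.lt_two_pow_self.trans_le
        (Nat.pow_le_pow_right (by norm_num) (hd.le.trans (Nat.le_mul_of_pos_right _ (by omega))))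
      exact_mod_cast h.le
    calc _ ≤ ∑ n ∈ range (N + 1), ∑ j ∈ range (d + 1), B * 2 ^ (k * (N + 1)) * ‖y' - y‖ := by
          refine norm_sum_le_of_le _ fun n _ => norm_sum_le_of_le _ fun j hj => ?_
          have hj' : (j : ℝ) ≤ d := by exact_mod_cast (by simp at hj; omega : j ≤ d)
          rw [norm_mul, norm_mul, norm_pow, norm_pow, hy1, one_pow, one_pow, mul_one, mul_assoc]
          gcongr
          · exact hB _
          · refine (norm_pow_sub_pow_le hy1' hy1 j).trans ?_
            gcongr
            exact hj'.trans hdk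
      _ = _ := by
          simp only [sum_const, card_range, nsmul_eq_mul]
          push_cast
          ring
  rw [e, mul_add]
  exact (norm_add_le _ _).trans (add_le_add h1 h2)

theorem one_le_norm_mul_pow {F : Type*} [Field F] [NumberField F] (φ : F →+* ℂ) {a : F}
    (ha : IsIntegral ℤ a) (ha0 : a ≠ 0) {T : ℝ} (hT1 : 1 ≤ T) (hT : ∀ ψ : F →+* ℂ, ‖ψ a‖ ≤ T) :
    1 ≤ ‖φ a‖ * T ^ Module.finrank ℚ F := by
  classical
  have hn : (1 : ℝ) ≤ ‖algebraMap ℚ ℂ (Algebra.norm ℚ a)‖ := by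
    obtain ⟨z, hz⟩ := IsIntegrallyClosed.isIntegral_iff.1 (Algebra.isIntegral_norm ℚ ha)
    have hz0 : z ≠ 0 := by
      rintro rfl
      rw [map_zero, eq_comm, Algebra.norm_eq_zero_iff] at hz
      exact ha0 hz
    rw [← hz]
    simp only [eq_intCast, map_intCast, Complex.norm_intCast]
    exact_mod_cast Int.one_le_abs hz0
  have hp : algebraMap ℚ ℂ (Algebra.norm ℚ a) = ∏ ψ : F →+* ℂ, ψ a := by
    rw [Algebra.norm_eq_prod_embeddings ℚ ℂ a]
    exact Fintype.prod_equiv (RingHom.equivRatAlgHom F ℂ).symm _ _ fun _ => rfl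
  rw [hp, norm_prod, ← mul_prod_erase _ _ (mem_univ φ)] at hn
  refine hn.trans (mul_le_mul_of_nonneg_left ?_ (norm_nonneg _))
  calc ∏ ψ ∈ univ.erase φ, ‖ψ a‖ ≤ ∏ ψ ∈ univ.erase φ, T :=
        prod_le_prod (fun _ _ => norm_nonneg _) fun ψ _ => hT ψ
    _ = T ^ (univ.erase φ).card := prod_const _
    _ ≤ T ^ Module.finrank ℚ F := by
        refine pow_le_pow_right₀ hT1 ?_
        rw [← NumberField.Embeddings.card F ℂ]
        exact card_le_univ _

theorem pow_mul_pow_lt_of_exponents {z₁ z₂ : ℝ} {l u p q r s t : ℕ} (hz : 1 < z₁) (hl : 1 ≤ l)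
    (h₁ : z₁ ^ l ≤ z₂) (h₂ : z₂ ≤ z₁ ^ u) (hr : p + u * q < r) (ht : p ≤ l * t) (hs : t + q < s) :
    z₁ ^ p * z₂ ^ q < z₁ ^ r ∧ z₁ ^ p * z₂ ^ q < z₂ ^ s := by
  have hz2 : 1 < z₂ := lt_of_lt_of_le (one_lt_pow₀ hz (by omega)) h₁
  have hz0 : 0 < z₁ := by linarith
  constructor
  · have h : z₁ ^ p * z₂ ^ q ≤ z₁ ^ p * (z₁ ^ u) ^ q := by gcongr
    rw [← pow_mul, ← pow_add] at h
    exact h.trans_lt (pow_lt_pow_right₀ hz hr)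
  · have h : z₁ ^ p ≤ (z₁ ^ l) ^ t := by
      rw [← pow_mul]
      exact pow_le_pow_right₀ hz.le ht
    have h' : z₁ ^ p * z₂ ^ q ≤ z₂ ^ t * z₂ ^ q := by
      gcongr
      exact h.trans (by gcongr)
    rw [← pow_add] at h'
    exact h'.trans_lt (pow_lt_pow_right₀ hz2 hs)

theorem first_gap_exponent_lt {e N : ℕ} (he : 1 ≤ e) (hN : 1 ≤ N) :
    N + e * (1000 * e ^ 2 * N + 8 * e) + 8 * e * (N + 1) * (e * (8 * e)) <
      (1000 * e ^ 2 - 1) * (N * (8 * e + 1)) := by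
  obtain ⟨k, hk⟩ : ∃ k, 1000 * e ^ 2 = k + 1 :=
    ⟨1000 * e ^ 2 - 1, by have := Nat.one_le_pow 2 e he; omega⟩
  rw [hk, Nat.add_sub_cancel]
  zify at *
  have hk' : (k : ℤ) = 1000 * e ^ 2 - 1 := by omega
  rw [hk']
  have h₀ : (0 : ℤ) ≤ (e - 1) * (N - 1) := mul_nonneg (by omega) (by omega)
  have h₁ : (0 : ℤ) ≤ e * (e - 1) * (N - 1) := by rw [mul_assoc]; positivity
  have h₂ : (0 : ℤ) ≤ e ^ 2 * (e - 1) * (N - 1) := by rw [mul_assoc]; positivity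
  have h₃ : (0 : ℤ) ≤ e * (e - 1) := mul_nonneg (by omega) (by omega)
  have h₄ : (0 : ℤ) ≤ e ^ 2 * (e - 1) := mul_nonneg (by positivity) (by omega)
  nlinarith

theorem second_gap_exponent_le {e N : ℕ} (he : 1 ≤ e) (hN : 1 ≤ N) :
    N + e * (1000 * e ^ 2 * N + 8 * e) ≤ 8 * e * N * (300 * e ^ 2) := by
  zify at *
  have h₀ : (0 : ℤ) ≤ (e - 1) * (N - 1) := mul_nonneg (by omega) (by omega)
  have h₁ : (0 : ℤ) ≤ e * (e - 1) * (N - 1) := by rw [mul_assoc]; positivity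
  have h₂ : (0 : ℤ) ≤ e ^ 2 * (e - 1) * (N - 1) := by rw [mul_assoc]; positivity
  have h₃ : (0 : ℤ) ≤ e * (e - 1) := mul_nonneg (by omega) (by omega)
  have h₄ : (0 : ℤ) ≤ e ^ 2 * (e - 1) := mul_nonneg (by positivity) (by omega)
  nlinarith

theorem gap_exponent_bounds {e N : ℕ} (he : 1 ≤ e) (hN : 1 ≤ N) {z₁ z₂ : ℝ} (hz : 1 < z₁)
    (h₁ : z₁ ^ (8 * e * N) ≤ z₂) (h₂ : z₂ ≤ z₁ ^ (8 * e * (N + 1))) :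
    z₁ ^ (N + e * (1000 * e ^ 2 * N + 8 * e)) * z₂ ^ (e * (8 * e)) <
        z₁ ^ ((1000 * e ^ 2 - 1) * (N * (8 * e + 1))) ∧
      z₁ ^ (N + e * (1000 * e ^ 2 * N + 8 * e)) * z₂ ^ (e * (8 * e)) < z₂ ^ (1000 * e ^ 2 - 1) := by
  have hl : 1 ≤ 8 * e * N := Nat.mul_pos (by omega) hN
  refine pow_mul_pow_lt_of_exponents (t := 300 * e ^ 2) hz hl h₁ h₂
    (first_gap_exponent_lt he hN) (second_gap_exponent_le he hN) ?_
  have := Nat.one_le_pow 2 e he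
  rw [show e * (8 * e) = 8 * e ^ 2 by ring]
  omega

/-- Two good approximations `w₁`, `w₂` to a `k`-th root of `β` by units, the second of which has a
much larger height than the first, cannot both be far from being exact. -/
theorem pow_eq_of_two_approximations {F : Type*} [Field F] [NumberField F] (φ : F →+* ℂ) {E e k : ℕ}
    (hE : 1 ≤ E) (he : e = E * Module.finrank ℚ F) (hk : k = 1000 * e ^ 2)
    {β : F} {ρ : ℂ} (hρ : ρ ^ k = φ β) (hρ1 : ‖ρ‖ = 1) :
    ∃ z₀ : ℝ, ∀ (w₁ w₂ : F) (z₁ z₂ : ℝ), z₀ ≤ z₁ → z₁ ^ (8 * e) ≤ z₂ →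
      IsIntegral ℤ w₁⁻¹ → IsIntegral ℤ w₂ →
      (∀ ψ : F →+* ℂ, ‖ψ w₁⁻¹‖ ≤ z₁ ^ E) → (∀ ψ : F →+* ℂ, ‖ψ w₂‖ ≤ z₂ ^ E) →
      ‖φ w₁‖ = 1 → ‖φ w₂‖ = 1 → ‖φ w₁ - ρ‖ * z₁ ^ (k - 1) ≤ 1 → ‖φ w₂ - ρ‖ * z₂ ^ (k - 1) ≤ 1 →
      w₁ ^ k = β := by
  set D := Module.finrank ℚ F with hD
  have hD1 : 1 ≤ D := Module.finrank_pos
  have he1 : 1 ≤ e := by rw [he]; exact Nat.mul_pos hE hD1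
  set d := 8 * e with hd
  have hdk : d < k := by rw [hk, hd]; nlinarith
  obtain ⟨C, hC⟩ := exists_hermitePade_coeff hdk
  have hC1 : (1 : ℝ) ≤ C := by
    obtain ⟨c, hc, htop, -⟩ := hC 0 0 (by omega)
    have h := hc (k * 0 + 0)
    have h' := Int.one_le_abs htop
    rw [zero_add, pow_one] at h
    exact_mod_cast h'.trans h
  obtain ⟨b, hb0, hb⟩ : ∃ b : ℤ, b ≠ 0 ∧ IsIntegral ℤ (algebraMap ℤ F b * β) := by
    obtain ⟨b, hb0, hb⟩ := ((IsFractionRing.isAlgebraic_iff ℤ ℚ F).mpr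
      (Algebra.IsAlgebraic.isAlgebraic β)).exists_integral_multiple
    exact ⟨b, hb0, by simpa [Algebra.smul_def] using hb⟩
  rw [eq_intCast] at hb
  have hb1 : (1 : ℝ) ≤ |(b : ℝ)| := by exact_mod_cast Int.one_le_abs hb0
  set Θ : ℝ := 1 + ∑ ψ : F →+* ℂ, ‖ψ β‖ with hΘ
  have hΘ1 : 1 ≤ Θ := le_add_of_nonneg_right (sum_nonneg fun _ _ => norm_nonneg _)
  have hΘβ : ∀ ψ : F →+* ℂ, ‖ψ β‖ ≤ Θ := fun ψ =>
    (single_le_sum (f := fun ψ : F →+* ℂ => ‖ψ β‖) (fun _ _ => norm_nonneg _) (mem_univ ψ)).trans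
      (by linarith)
  set κ : ℝ := |(b : ℝ)| * (2 * (d + 1)) * C ^ 2 * 4 ^ k * Θ with hκ
  have hκ1 : 1 ≤ κ := by
    have h1 : (1 : ℝ) ≤ 2 * (d + 1) := by have : (0 : ℝ) ≤ d := Nat.cast_nonneg d; linarith
    have h2 : (1 : ℝ) ≤ C ^ 2 := one_le_pow₀ hC1
    have h3 : (1 : ℝ) ≤ 4 ^ k := one_le_pow₀ (by norm_num)
    exact one_le_mul_of_one_le_of_one_le (one_le_mul_of_one_le_of_one_le
      (one_le_mul_of_one_le_of_one_le (one_le_mul_of_one_le_of_one_le hb1 h1) h2) h3) hΘ1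
  have hκN : ∀ N : ℕ, 1 ≤ N →
      |(b : ℝ)| ^ N * ((N + 1) * (d + 1) * C ^ (N + 1) * 2 ^ (k * (N + 1))) * Θ ^ N ≤ κ ^ N := by
    intro N hN
    have h1 : (N + 1 : ℝ) ≤ 2 ^ N := by exact_mod_cast Nat.lt_two_pow_self
    have h2 : (d + 1 : ℝ) ≤ (d + 1) ^ N :=
      le_self_pow₀ (by have : (0 : ℝ) ≤ d := Nat.cast_nonneg d; linarith) (by omega)
    have h3 : (C : ℝ) ^ (N + 1) ≤ (C ^ 2) ^ N := by
      rw [← pow_mul]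
      exact pow_le_pow_right₀ hC1 (by omega)
    have h4 : (2 : ℝ) ^ (k * (N + 1)) ≤ (4 ^ k) ^ N := by
      rw [show (4 : ℝ) = 2 ^ 2 by norm_num, ← pow_mul, ← pow_mul]
      exact pow_le_pow_right₀ (by norm_num) (by nlinarith)
    calc _ ≤ |(b : ℝ)| ^ N * (2 ^ N * (d + 1) ^ N * (C ^ 2) ^ N * (4 ^ k) ^ N) * Θ ^ N := by gcongr
      _ = κ ^ N := by simp only [hκ, mul_pow]; ring
  refine ⟨2 * κ ^ (D + 1), fun w₁ w₂ z₁ z₂ hz₁ hz₂ hi₁ hi₂ hw₁ hw₂ hn₁ hn₂ hr₁ hr₂ => ?_⟩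
  by_contra hne
  have hz1 : 1 < z₁ := by have := one_le_pow₀ hκ1 (n := D + 1); linarith
  have hz0 : 0 < z₁ := by linarith
  have hy1 : 1 < z₁ ^ d := one_lt_pow₀ hz1 (by omega)
  have hz2 : 1 < z₂ := lt_of_lt_of_le hy1 hz₂
  have hz20 : 0 < z₂ := by linarith
  obtain ⟨N, hN1, hN2⟩ := exists_nat_pow_near hz2.le hy1
  have hN : 1 ≤ N := by
    by_contra h
    obtain rfl : N = 0 := by omega
    rw [zero_add, pow_one] at hN2
    linarith
  rw [← pow_mul] at hN1 hN2
  obtain ⟨hgap₁, hgap₂⟩ := gap_exponent_bounds he1 hN hz1 hN1 hN2.le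
  rw [← hk, ← hd] at hgap₁ hgap₂
  have hφ1 : φ w₁ ≠ 0 := fun h => by rw [h, norm_zero] at hn₁; exact zero_ne_one hn₁
  have hw10 : w₁ ≠ 0 := fun h => hφ1 (by rw [h, map_zero])
  set x : F := β * w₁⁻¹ ^ k with hx
  set y : F := w₂ * w₁⁻¹ with hy
  have hx1 : x ≠ 1 := by
    intro h
    apply hne
    rw [hx, inv_pow, mul_inv_eq_one₀ (pow_ne_zero _ hw10)] at h
    exact h.symm
  choose! c hc htop hsupp hvan using hC N
  obtain ⟨i, hi, hsum⟩ := exists_sum_hermitePade_ne_zero hdk N c htop hsupp hvan hx1 y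
  have hcB : ∀ l, ‖(c i l : ℂ)‖ ≤ (C : ℝ) ^ (N + 1) := fun l => by
    rw [Complex.norm_intCast]
    exact_mod_cast hc i hi l
  set a : F := (b : F) ^ N * ∑ n ∈ range (N + 1), ∑ j ∈ range (d + 1),
    (c i (k * n + j) : F) * x ^ n * y ^ j with ha
  have ha0 : a ≠ 0 := mul_ne_zero (pow_ne_zero _ (by exact_mod_cast hb0)) hsum
  have haint : IsIntegral ℤ a := by
    rw [ha, mul_sum]
    refine IsIntegral.sum _ fun n hn => ?_
    rw [mul_sum]
    refine IsIntegral.sum _ fun j _ => ?_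
    have hn' : n ≤ N := by simp at hn; omega
    have e : (b : F) ^ N * ((c i (k * n + j) : F) * x ^ n * y ^ j) =
        (b : F) ^ (N - n) * (c i (k * n + j) : F) * ((b : F) * β) ^ n * (w₁⁻¹ ^ k) ^ n *
          (w₂ * w₁⁻¹) ^ j := by
      rw [hx, hy, ← Nat.sub_add_cancel hn', pow_add, Nat.add_sub_cancel]
      ring
    rw [e]
    have hZ : ∀ z : ℤ, IsIntegral ℤ (z : F) := fun z => by
      simpa using isIntegral_algebraMap (R := ℤ) (A := F) (x := z)
    exact ((((hZ b).pow _).mul (hZ _)).mul (hb.pow _)).mul ((hi₁.pow _).pow _) |>.mul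
      ((hi₂.mul hi₁).pow _)
  set T : ℝ := κ ^ N * (z₁ ^ (E * (k * N + d)) * z₂ ^ (E * d)) with hT
  have hT1 : 1 ≤ T := one_le_mul_of_one_le_of_one_le (one_le_pow₀ hκ1)
    (one_le_mul_of_one_le_of_one_le (one_le_pow₀ hz1.le) (one_le_pow₀ hz2.le))
  have haT : ∀ ψ : F →+* ℂ, ‖ψ a‖ ≤ T := by
    intro ψ
    have hterm : ∀ n ∈ range (N + 1), ∀ j ∈ range (d + 1),
        ‖(c i (k * n + j) : ℂ) * ψ x ^ n * ψ y ^ j‖ ≤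
          C ^ (N + 1) * (Θ ^ N * (z₁ ^ (E * (k * N + d)) * z₂ ^ (E * d))) := by
      intro n hn j hj
      have hn' : n ≤ N := by simp at hn; omega
      have hj' : j ≤ d := by simp at hj; omega
      have hxn : ‖ψ x‖ ≤ Θ * (z₁ ^ E) ^ k := by
        rw [hx, map_mul, map_pow, norm_mul, norm_pow]
        gcongr
        · exact hΘβ ψ
        · exact hw₁ ψ
      have hyn : ‖ψ y‖ ≤ z₂ ^ E * z₁ ^ E := by
        rw [hy, map_mul, norm_mul]
        gcongr
        · exact hw₂ ψ
        · exact hw₁ ψ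
      have hzE : 1 ≤ z₁ ^ E := one_le_pow₀ hz1.le
      have hzE2 : 1 ≤ z₂ ^ E := one_le_pow₀ hz2.le
      calc _ ≤ (C : ℝ) ^ (N + 1) * (Θ * (z₁ ^ E) ^ k) ^ n * (z₂ ^ E * z₁ ^ E) ^ j := by
            rw [norm_mul, norm_mul, norm_pow, norm_pow]
            gcongr
            exact hcB _
        _ ≤ (C : ℝ) ^ (N + 1) * (Θ * (z₁ ^ E) ^ k) ^ N * (z₂ ^ E * z₁ ^ E) ^ d := by
            have h1 : 1 ≤ Θ * (z₁ ^ E) ^ k :=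
              one_le_mul_of_one_le_of_one_le hΘ1 (one_le_pow₀ hzE)
            have h2 := one_le_mul_of_one_le_of_one_le hzE2 hzE
            gcongr
        _ = _ := by
            simp only [mul_pow, ← pow_mul, mul_add, pow_add]
            ring
    have hsum' : ‖∑ n ∈ range (N + 1), ∑ j ∈ range (d + 1),
        (c i (k * n + j) : ℂ) * ψ x ^ n * ψ y ^ j‖ ≤
        (N + 1) * (d + 1) * (C ^ (N + 1) * (Θ ^ N * (z₁ ^ (E * (k * N + d)) * z₂ ^ (E * d)))) := by
      refine (norm_sum_le_of_le _ fun n hn => norm_sum_le_of_le _ (hterm n hn)).trans (le_of_eq ?_)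
      simp only [sum_const, card_range, nsmul_eq_mul]
      push_cast
      ring
    have hψ : ψ a = (b : ℂ) ^ N * ∑ n ∈ range (N + 1), ∑ j ∈ range (d + 1),
        (c i (k * n + j) : ℂ) * ψ x ^ n * ψ y ^ j := by
      simp only [ha, map_mul, map_pow, map_sum, map_intCast]
    rw [hψ, norm_mul, norm_pow, Complex.norm_intCast]
    calc _ ≤ |(b : ℝ)| ^ N * ((N + 1) * (d + 1) *
          (C ^ (N + 1) * (Θ ^ N * (z₁ ^ (E * (k * N + d)) * z₂ ^ (E * d))))) := by gcongr
      _ = |(b : ℝ)| ^ N * ((N + 1) * (d + 1) * C ^ (N + 1) * 1) * Θ ^ N *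
          (z₁ ^ (E * (k * N + d)) * z₂ ^ (E * d)) := by ring
      _ ≤ |(b : ℝ)| ^ N * ((N + 1) * (d + 1) * C ^ (N + 1) * 2 ^ (k * (N + 1))) * Θ ^ N *
          (z₁ ^ (E * (k * N + d)) * z₂ ^ (E * d)) := by
          gcongr
          exact one_le_pow₀ (by norm_num)
      _ ≤ T := by
          rw [hT]
          gcongr
          exact hκN N hN
  have hk1 : k - 1 ≠ 0 := by rw [hk]; have := Nat.one_le_pow 2 e he1; omega
  have hφa : ‖φ a‖ ≤ κ ^ N * (‖φ w₁ - ρ‖ ^ (N * (d + 1)) + ‖φ w₂ - ρ‖) := by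
    have hyk : φ x = (ρ * (φ w₁)⁻¹) ^ k := by
      rw [hx, map_mul, map_pow, map_inv₀, mul_pow, hρ]
    have hd1 : ‖ρ * (φ w₁)⁻¹ - 1‖ = ‖φ w₁ - ρ‖ := by
      rw [show ρ * (φ w₁)⁻¹ - 1 = (ρ - φ w₁) * (φ w₁)⁻¹ by field_simp, norm_mul, norm_inv, hn₁,
        inv_one, mul_one, norm_sub_rev]
    have hd2 : ‖φ y - ρ * (φ w₁)⁻¹‖ = ‖φ w₂ - ρ‖ := by
      rw [hy, map_mul, map_inv₀, ← sub_mul, norm_mul, norm_inv, hn₁, inv_one, mul_one]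
    have hle : ‖φ w₁ - ρ‖ ≤ 1 :=
      (le_mul_of_one_le_right (norm_nonneg _) (one_le_pow₀ hz1.le)).trans hr₁
    have h := norm_sum_le_of_vanishing_two hdk N (c i) hcB (hvan i hi)
      (y := ρ * (φ w₁)⁻¹) (y' := φ y) (by rw [hd1]; exact hle)
      (by rw [norm_mul, norm_inv, hn₁, hρ1, inv_one, mul_one])
      (by rw [hy, map_mul, map_inv₀, norm_mul, norm_inv, hn₁, hn₂, inv_one, mul_one])
    rw [← hyk, hd1, hd2] at h
    have hφ : φ a = (b : ℂ) ^ N * ∑ n ∈ range (N + 1), ∑ j ∈ range (d + 1),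
        (c i (k * n + j) : ℂ) * φ x ^ n * φ y ^ j := by
      simp only [ha, map_mul, map_pow, map_sum, map_intCast]
    rw [hφ, norm_mul, norm_pow, Complex.norm_intCast]
    have hΘN : 1 ≤ Θ ^ N := one_le_pow₀ hΘ1
    calc _ ≤ |(b : ℝ)| ^ N * ((N + 1) * (d + 1) * C ^ (N + 1) * 2 ^ (k * (N + 1)) *
          (‖φ w₁ - ρ‖ ^ (N * (d + 1)) + ‖φ w₂ - ρ‖)) := by gcongr
      _ = |(b : ℝ)| ^ N * ((N + 1) * (d + 1) * C ^ (N + 1) * 2 ^ (k * (N + 1))) * 1 *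
          (‖φ w₁ - ρ‖ ^ (N * (d + 1)) + ‖φ w₂ - ρ‖) := by ring
      _ ≤ |(b : ℝ)| ^ N * ((N + 1) * (d + 1) * C ^ (N + 1) * 2 ^ (k * (N + 1))) * Θ ^ N *
          (‖φ w₁ - ρ‖ ^ (N * (d + 1)) + ‖φ w₂ - ρ‖) := by gcongr
      _ ≤ _ := by
          gcongr
          exact hκN N hN
  set U : ℝ := z₁ ^ (N + e * (k * N + d)) * z₂ ^ (e * d) with hU
  have hU0 : 0 < U := by positivity
  have hp₁ : U * ‖φ w₁ - ρ‖ ^ (N * (d + 1)) < 1 := by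
    have h1 : ‖φ w₁ - ρ‖ ^ (N * (d + 1)) * z₁ ^ ((k - 1) * (N * (d + 1))) ≤ 1 := by
      rw [pow_mul z₁, ← mul_pow]
      exact pow_le_one₀ (by positivity) hr₁
    rcases (by positivity : 0 ≤ ‖φ w₁ - ρ‖ ^ (N * (d + 1))).eq_or_lt with h0 | h0
    · rw [← h0, mul_zero]
      exact one_pos
    · exact (mul_comm U _ ▸ mul_lt_mul_of_pos_left hgap₁ h0).trans_le h1
  have hp₂ : U * ‖φ w₂ - ρ‖ < 1 := by
    rcases (norm_nonneg (φ w₂ - ρ)).eq_or_lt with h0 | h0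
    · rw [← h0, mul_zero]
      exact one_pos
    · exact (mul_comm U _ ▸ mul_lt_mul_of_pos_left hgap₂ h0).trans_le hr₂
  have hmain := one_le_norm_mul_pow φ haint ha0 hT1 haT
  rw [← hD] at hmain
  clear_value κ U Θ D
  have hfin : ‖φ a‖ * T ^ D ≤ 1 / 2 * (U * (‖φ w₁ - ρ‖ ^ (N * (d + 1)) + ‖φ w₂ - ρ‖)) := by
    have hκz : κ ^ N * (κ ^ N) ^ D ≤ 1 / 2 * z₁ ^ N := by
      have h1 : (2 * κ ^ (D + 1)) ^ N ≤ z₁ ^ N := by gcongr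
      rw [mul_pow] at h1
      have h2 : (2 : ℝ) ≤ 2 ^ N := le_self_pow₀ (by norm_num) (by omega)
      have h3 : 0 < (κ ^ (D + 1)) ^ N := by positivity
      have h4 : κ ^ N * (κ ^ N) ^ D = (κ ^ (D + 1)) ^ N := by
        rw [← pow_succ', ← pow_mul, ← pow_mul, mul_comm]
      rw [h4]
      nlinarith
    set s := ‖φ w₁ - ρ‖ ^ (N * (d + 1)) + ‖φ w₂ - ρ‖ with hs
    have hs0 : 0 ≤ s := by positivity
    calc ‖φ a‖ * T ^ D ≤ κ ^ N * s * T ^ D := by gcongr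
      _ = κ ^ N * (κ ^ N) ^ D * (z₁ ^ (e * (k * N + d)) * z₂ ^ (e * d)) * s := by
          rw [hT, he]
          simp only [mul_pow, ← pow_mul]
          rw [show E * (k * N + d) * D = E * D * (k * N + d) by ring,
            show E * d * D = E * D * d by ring]
          ring
      _ ≤ 1 / 2 * z₁ ^ N * (z₁ ^ (e * (k * N + d)) * z₂ ^ (e * d)) * s := by gcongr
      _ = _ := by rw [hU, pow_add]; ring
  rw [mul_add] at hfin
  linarith

theorem det_smul_sub_det_smul_add_det_smul {R : Type*} [CommRing R] (a b s t : Fin 3 → R)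
    (i : Fin 3) :
    (Matrix.of ![a, s, t]).det * b i =
      (Matrix.of ![b, s, t]).det * a i - (Matrix.of ![b, a, t]).det * s i +
        (Matrix.of ![b, a, s]).det * t i := by
  fin_cases i <;> simp [Matrix.det_fin_three] <;> ring

theorem exists_det_single_ne_zero {R : Type*} [CommRing R] {s t : Fin 3 → R}
    (h : ∃ i j, s i * t j ≠ s j * t i) :
    ∃ l, (Matrix.of ![Pi.single l 1, s, t]).det ≠ 0 := by
  by_contra! h0
  obtain ⟨i, j, hij⟩ := h
  have h₀ := h0 0
  have h₁ := h0 1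
  have h₂ := h0 2
  simp [Matrix.det_fin_three] at h₀ h₁ h₂
  apply hij
  fin_cases i <;> fin_cases j <;> simp <;> grind

theorem det_mem {L : Subfield ℂ} {p q r : Fin 3 → ℂ} (hp : ∀ i, p i ∈ L) (hq : ∀ i, q i ∈ L)
    (hr : ∀ i, r i ∈ L) : (Matrix.of ![p, q, r]).det ∈ L := by
  simp only [Matrix.det_fin_three]
  simp only [Matrix.of_apply, Matrix.cons_val]
  apply_rules [sub_mem, add_mem, mul_mem]

/-- If a linear form `s` in three variables and its conjugate are independent, then for every form
`a` there is `c` such that on the real points where `s` is bounded, either `a` is bounded or the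
conjugate of `a` is within a bounded distance of `c * a`. -/
theorem exists_norm_conj_sub_mul_le {L : Subfield ℂ} {s a : Fin 3 → ℂ}
    (hs : ∀ i, s i ∈ L) (hs' : ∀ i, (starRingEnd ℂ) (s i) ∈ L) (ha : ∀ i, a i ∈ L)
    (ha' : ∀ i, (starRingEnd ℂ) (a i) ∈ L)
    (h : ∃ i j, s i * (starRingEnd ℂ) (s j) ≠ s j * (starRingEnd ℂ) (s i)) (B : ℝ) :
    ∃ c ∈ L, ∃ B' : ℝ, ∀ x : Fin 3 → ℝ, ‖∑ i, (x i : ℂ) * s i‖ ≤ B →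
      ‖∑ i, (x i : ℂ) * a i‖ ≤ B' ∨
        ‖(starRingEnd ℂ) (∑ i, (x i : ℂ) * a i) - c * ∑ i, (x i : ℂ) * a i‖ ≤ B' := by
  set t : Fin 3 → ℂ := fun i => (starRingEnd ℂ) (s i) with ht
  have hconj : ∀ (x : Fin 3 → ℝ) (v : Fin 3 → ℂ), (starRingEnd ℂ) (∑ i, (x i : ℂ) * v i) =
      ∑ i, (x i : ℂ) * (starRingEnd ℂ) (v i) := fun x v => by
    simp only [map_sum, map_mul, Complex.conj_ofReal]
  have hbound : ∀ (p q : ℂ) (x : Fin 3 → ℝ), ‖∑ i, (x i : ℂ) * s i‖ ≤ B →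
      ‖p * ∑ i, (x i : ℂ) * s i + q * ∑ i, (x i : ℂ) * t i‖ ≤ (‖p‖ + ‖q‖) * B := by
    intro p q x hx
    have hx' : ‖∑ i, (x i : ℂ) * t i‖ ≤ B := by
      rw [ht, ← hconj, Complex.norm_conj]
      exact hx
    refine (norm_add_le _ _).trans ?_
    rw [norm_mul, norm_mul, add_mul]
    gcongr
  by_cases hd : (Matrix.of ![a, s, t]).det = 0
  · obtain ⟨l, hl⟩ := exists_det_single_ne_zero (t := t) h
    obtain ⟨p, q, hpq⟩ : ∃ p q : ℂ, ∀ x : Fin 3 → ℝ, ∑ i, (x i : ℂ) * a i =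
        p * ∑ i, (x i : ℂ) * s i + q * ∑ i, (x i : ℂ) * t i := by
      refine ⟨(Matrix.of ![Pi.single l 1, a, t]).det / (Matrix.of ![Pi.single l 1, s, t]).det,
        -(Matrix.of ![Pi.single l 1, a, s]).det / (Matrix.of ![Pi.single l 1, s, t]).det,
        fun x => ?_⟩
      simp only [mul_sum, ← sum_add_distrib]
      refine sum_congr rfl fun i _ => ?_
      have h4 := det_smul_sub_det_smul_add_det_smul a (Pi.single l 1) s t i
      rw [hd, zero_mul] at h4
      field_simp
      linear_combination (-(x i : ℂ)) * h4
    exact ⟨0, L.zero_mem, _, fun x hx => Or.inl (hpq x ▸ hbound p q x hx)⟩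
  · set c := (Matrix.of ![fun i => (starRingEnd ℂ) (a i), s, t]).det / (Matrix.of ![a, s, t]).det
    obtain ⟨p, q, hpq⟩ : ∃ p q : ℂ, ∀ x : Fin 3 → ℝ,
        (starRingEnd ℂ) (∑ i, (x i : ℂ) * a i) - c * ∑ i, (x i : ℂ) * a i =
          p * ∑ i, (x i : ℂ) * s i + q * ∑ i, (x i : ℂ) * t i := by
      refine ⟨-(Matrix.of ![fun i => (starRingEnd ℂ) (a i), a, t]).det / (Matrix.of ![a, s, t]).det,
        (Matrix.of ![fun i => (starRingEnd ℂ) (a i), a, s]).det / (Matrix.of ![a, s, t]).det,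
        fun x => ?_⟩
      rw [hconj]
      simp only [c, mul_sum, ← sum_add_distrib, ← sum_sub_distrib]
      refine sum_congr rfl fun i _ => ?_
      have h4 := det_smul_sub_det_smul_add_det_smul a (fun i => (starRingEnd ℂ) (a i)) s t i
      field_simp
      linear_combination (x i : ℂ) * h4
    exact ⟨c, div_mem (det_mem ha' hs hs') (det_mem ha hs hs'), _,
      fun x hx => Or.inr (hpq x ▸ hbound p q x hx)⟩

theorem exists_mul_conjugate_ne {K : Type*} [Field K] [NumberField K] {α : Fin 3 → K}
    (hgen : IntermediateField.adjoin ℚ {x : K | ∃ i j, x = α i / α j} = ⊤) {σ : K →+* ℂ}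
    (hσ : ¬ ComplexEmbedding.IsReal σ) :
    ∃ i j, σ (α i) * (starRingEnd ℂ) (σ (α j)) ≠ σ (α j) * (starRingEnd ℂ) (σ (α i)) := by
  by_contra! h
  refine hσ (RingHom.ext fun x => ?_)
  have hx : x ∈ IntermediateField.adjoin ℚ {x : K | ∃ i j, x = α i / α j} := by
    rw [hgen]; trivial
  rw [ComplexEmbedding.conjugate_coe_eq]
  induction hx using IntermediateField.adjoin_induction with
  | mem x hx =>
    obtain ⟨i, j, rfl⟩ := hx
    by_cases hj : α j = 0
    · simp [hj]
    have h0 : σ (α j) ≠ 0 := by simpa using hj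
    rw [map_div₀, map_div₀, div_eq_div_iff (by simpa using hj) h0]
    linear_combination -h i j
  | algebraMap q => simp
  | add x y _ _ hx hy => simp only [map_add, hx, hy]
  | inv x _ hx => simp only [map_inv₀, hx]
  | mul x y _ _ hx hy => simp only [map_mul, hx, hy]

theorem prod_norm_embeddings {K : Type*} [Field K] [NumberField K] (x : K) :
    ∏ φ : K →+* ℂ, ‖φ x‖ = |((Algebra.norm ℚ x : ℚ) : ℝ)| := by
  have h := congrArg norm (Algebra.norm_eq_prod_embeddings ℚ ℂ x)
  rw [norm_prod, eq_ratCast, Complex.norm_ratCast] at h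
  rw [h]
  exact Fintype.prod_equiv (RingHom.equivRatAlgHom K ℂ) _ _ fun _ => rfl

theorem finite_quotient_range_powMonoidHom {G : Type*} [CommGroup G] [Group.FG G] {k : ℕ}
    (hk : k ≠ 0) : Finite (G ⧸ (powMonoidHom k : G →* G).range) := by
  refine CommGroup.finite_of_fg_isMulTorsion _ fun x => ?_
  induction x using QuotientGroup.induction_on with | H g => ?_
  refine isOfFinOrder_iff_pow_eq_one.mpr ⟨k, Nat.pos_of_ne_zero hk, ?_⟩
  rw [← QuotientGroup.mk_pow, QuotientGroup.eq_one_iff]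
  exact ⟨g, rfl⟩

/-- Up to `k`-th powers of units there are finitely many integers of given norm. -/
theorem exists_finite_norm_eq_mul_unit_pow (K : Type*) [Field K] [NumberField K] (m : ℕ) {k : ℕ}
    (hk : k ≠ 0) : ∃ M : Set (𝓞 K), M.Finite ∧ ∀ u : 𝓞 K, (Algebra.norm ℤ u).natAbs = m →
      ∃ μ ∈ M, ∃ ω : (𝓞 K)ˣ, u = μ * (ω : 𝓞 K) ^ k := by
  classical
  have : Group.FG (𝓞 K)ˣ := Group.fg_iff_monoid_fg.mpr inferInstance
  have := finite_quotient_range_powMonoidHom (G := (𝓞 K)ˣ) hk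
  let r : Ideal (𝓞 K) → 𝓞 K := fun I => if h : ∃ x, Ideal.span {x} = I then h.choose else 0
  have hr : ∀ u, Associated (r (Ideal.span {u})) u := fun u => by
    have h : ∃ x, Ideal.span {x} = Ideal.span {u} := ⟨u, rfl⟩
    simp only [r, dif_pos h]
    exact Ideal.span_singleton_eq_span_singleton.mp h.choose_spec
  refine ⟨Set.image2 (fun I q => r I * ((Quotient.out q : (𝓞 K)ˣ) : 𝓞 K))
    {I | Ideal.absNorm I = m} (Set.univ : Set ((𝓞 K)ˣ ⧸ (powMonoidHom k : (𝓞 K)ˣ →* _).range)),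
    (Ideal.finite_setOfPred_absNorm_eq m).image2 _ Set.finite_univ, fun u hu => ?_⟩
  obtain ⟨ε, hε⟩ := hr u
  refine ⟨_, ⟨Ideal.span {u}, ?_, QuotientGroup.mk ε, Set.mem_univ _, rfl⟩, ?_⟩
  · simpa [Ideal.absNorm_span_singleton] using hu
  · obtain ⟨⟨_, ω, rfl⟩, hω⟩ :=
      QuotientGroup.mk_out_eq_mul (powMonoidHom k : (𝓞 K)ˣ →* (𝓞 K)ˣ).range ε
    refine ⟨ω⁻¹, ?_⟩
    beta_reduce
    rw [hω, mul_assoc, ← Units.val_pow_eq_pow_val, ← Units.val_mul]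
    simpa using hε.symm

theorem norm_embedding_unit_inv_le {K : Type*} [Field K] [NumberField K] {ω : (𝓞 K)ˣ} {Y : ℝ}
    (hY : 1 ≤ Y) (h : ∀ φ : K →+* ℂ, ‖φ (ω : 𝓞 K)‖ ≤ Y) (φ : K →+* ℂ) :
    ‖φ ((ω⁻¹ : (𝓞 K)ˣ) : 𝓞 K)‖ ≤ Y ^ Module.finrank ℚ K := by
  classical
  have hprod : ∏ ψ : K →+* ℂ, ‖ψ (ω : 𝓞 K)‖ = 1 := by
    rw [prod_norm_embeddings, ← Rat.cast_abs]
    exact_mod_cast Units.norm K ω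
  rw [← mul_prod_erase _ _ (mem_univ φ)] at hprod
  have hinv : φ ((ω⁻¹ : (𝓞 K)ˣ) : 𝓞 K) = (φ (ω : 𝓞 K))⁻¹ := by
    rw [← map_inv₀]
    congr 1
    exact eq_inv_of_mul_eq_one_left (by rw [← map_mul, ← Units.val_mul]; simp)
  rw [hinv, norm_inv, inv_eq_of_mul_eq_one_right hprod]
  calc ∏ ψ ∈ univ.erase φ, ‖ψ (ω : 𝓞 K)‖ ≤ ∏ ψ ∈ univ.erase φ, Y :=
        prod_le_prod (fun _ _ => norm_nonneg _) fun ψ _ => h ψ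
    _ ≤ Y ^ Module.finrank ℚ K := by
        rw [prod_const, ← Embeddings.card K ℂ]
        exact pow_le_pow_right₀ hY (card_le_univ _)

theorem norm_mul_embedding_unit_inv_le {K F : Type*} [Field K] [NumberField K] [Field F]
    {ω : (𝓞 K)ˣ} {Y : ℝ} (hY : 1 ≤ Y) (h : ∀ φ : K →+* ℂ, ‖φ (ω : 𝓞 K)‖ ≤ Y) (i j : K →+* F)
    (ψ : F →+* ℂ) :
    ‖ψ (i (ω : 𝓞 K) * j ((ω⁻¹ : (𝓞 K)ˣ) : 𝓞 K))‖ ≤ Y ^ (Module.finrank ℚ K + 1) := by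
  rw [map_mul, norm_mul, pow_succ']
  exact mul_le_mul (h (ψ.comp i)) (norm_embedding_unit_inv_le hY h (ψ.comp j)) (norm_nonneg _)
    (by positivity)

theorem eventually_norm_sub_mul_le {w : ℕ → ℂ} {ρ μ c : ℂ} {H : ℕ → ℝ} {B : ℝ} {k : ℕ}
    (hk : 2 ≤ k) (hw : ∀ n, ‖w n‖ = 1) (hμ : ‖μ‖ = 1)
    (hlim : Filter.Tendsto w Filter.atTop (nhds ρ)) (hH : Filter.Tendsto H Filter.atTop Filter.atTop)
    (h : ∀ n, ‖μ * w n ^ k - c‖ * H n ≤ B) :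
    ‖ρ‖ = 1 ∧ μ * ρ ^ k = c ∧ ∀ᶠ n in Filter.atTop, ‖w n - ρ‖ * H n ≤ B := by
  have hρ : ‖ρ‖ = 1 :=
    tendsto_nhds_unique hlim.norm (by simp only [hw]; exact tendsto_const_nhds)
  have hc : μ * ρ ^ k = c := by
    have h1 : Filter.Tendsto (fun n => ‖μ * w n ^ k - c‖) Filter.atTop (nhds ‖μ * ρ ^ k - c‖) :=
      (((hlim.pow k).const_mul μ).sub_const c).norm
    have h2 : Filter.Tendsto (fun n => B / H n) Filter.atTop (nhds 0) :=
      hH.const_div_atTop B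
    have h3 := le_of_tendsto_of_tendsto h1 h2 (by
      filter_upwards [hH.eventually_gt_atTop 0] with n hn
      rw [le_div_iff₀ hn]
      exact h n)
    exact sub_eq_zero.mp (norm_le_zero_iff.mp h3)
  refine ⟨hρ, hc, ?_⟩
  have hG : Filter.Tendsto (fun n => ‖∑ i ∈ range k, w n ^ i * ρ ^ (k - 1 - i)‖) Filter.atTop
      (nhds k) := by
    have h1 : Filter.Tendsto (fun n => ‖∑ i ∈ range k, w n ^ i * ρ ^ (k - 1 - i)‖) Filter.atTop
        (nhds ‖∑ i ∈ range k, ρ ^ i * ρ ^ (k - 1 - i)‖) :=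
      (tendsto_finsetSum _ fun i _ => (hlim.pow i).mul_const _).norm
    have h2 : ∑ i ∈ range k, ρ ^ i * ρ ^ (k - 1 - i) = k * ρ ^ (k - 1) := by
      rw [sum_congr rfl fun i hi => show _ = ρ ^ (k - 1) by
        rw [← pow_add]; congr 1; have := mem_range.mp hi; omega]
      simp
    rw [h2, norm_mul, norm_pow, hρ, one_pow, mul_one, Complex.norm_natCast] at h1
    exact h1
  have hk1 : (1 : ℝ) < k := by exact_mod_cast hk
  filter_upwards [hG.eventually_const_lt hk1, hH.eventually_gt_atTop 0] with n hn hHn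
  refine le_trans ?_ (h n)
  gcongr
  rw [← hc, ← mul_sub, norm_mul, hμ, one_mul, ← (Commute.all (w n) ρ).geom_sum₂_mul, norm_mul]
  exact le_mul_of_one_le_left (norm_nonneg _) hn.le

/-- Along a sequence of units `ω` such that the size of `μ * ω ^ k` tends to infinity, the ratio
`conj (τ u) / τ u` for `u = μ * ω ^ k` cannot approximate `c` well without being equal to it. -/
theorem eventually_conj_div_eq {K F : Type*} [Field K] [NumberField K] [Field F] [NumberField F]
    (φ₀ : F →+* ℂ) (hF : ∀ τ : K →+* ℂ, ∃ i : K →+* F, φ₀.comp i = τ) (τ : K →+* ℂ) (c : F)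
    {E e k : ℕ} (hE : E = 2 * (Module.finrank ℚ K + 1)) (he : e = E * Module.finrank ℚ F)
    (hk : k = 1000 * e ^ 2) {μ : 𝓞 K} (hμ : μ ≠ 0) {B : ℝ} {ω : ℕ → (𝓞 K)ˣ}
    (hmax : ∀ n, ∀ φ : K →+* ℂ,
      ‖φ (μ * (ω n : 𝓞 K) ^ k : 𝓞 K)‖ ≤ ‖τ (μ * (ω n : 𝓞 K) ^ k : 𝓞 K)‖)
    (happ : ∀ n, ‖(starRingEnd ℂ) (τ (μ * (ω n : 𝓞 K) ^ k : 𝓞 K)) -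
      φ₀ c * τ (μ * (ω n : 𝓞 K) ^ k : 𝓞 K)‖ ≤ B)
    (hH : Filter.Tendsto (fun n => ‖τ (μ * (ω n : 𝓞 K) ^ k : 𝓞 K)‖) Filter.atTop Filter.atTop)
    {ρ : ℂ} (hlim : Filter.Tendsto (fun n => (starRingEnd ℂ) (τ (ω n : 𝓞 K)) / τ (ω n : 𝓞 K))
      Filter.atTop (nhds ρ)) :
    ∀ᶠ n in Filter.atTop, (starRingEnd ℂ) (τ (μ * (ω n : 𝓞 K) ^ k : 𝓞 K)) /
      τ (μ * (ω n : 𝓞 K) ^ k : 𝓞 K) = φ₀ c := by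
  have hE1 : 1 ≤ E := by omega
  have he1 : 1 ≤ e := by rw [he]; exact Nat.mul_pos hE1 Module.finrank_pos
  have hk2 : 2 ≤ k := by have := Nat.one_le_pow 2 e he1; omega
  set τ' := ComplexEmbedding.conjugate τ with hτ'
  have hcj : ∀ x : K, (starRingEnd ℂ) (τ x) = τ' x := fun x =>
    (ComplexEmbedding.conjugate_coe_eq τ x).symm
  simp only [hcj] at happ hlim ⊢
  obtain ⟨i, hi⟩ := hF τ
  obtain ⟨i', hi'⟩ := hF τ'
  have hi_apply : ∀ x, φ₀ (i x) = τ x := fun x => by rw [← hi]; rfl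
  have hi'_apply : ∀ x, φ₀ (i' x) = τ' x := fun x => by rw [← hi']; rfl
  have hnorm : ∀ x, ‖τ' x‖ = ‖τ x‖ := fun x => by rw [← hcj, Complex.norm_conj]
  set w : ℕ → ℂ := fun n => τ' (ω n : 𝓞 K) / τ (ω n : 𝓞 K) with hw
  set H : ℕ → ℝ := fun n => ‖τ (μ * (ω n : 𝓞 K) ^ k : 𝓞 K)‖
  have hratio : ∀ n, τ' (μ * (ω n : 𝓞 K) ^ k : 𝓞 K) / τ (μ * (ω n : 𝓞 K) ^ k : 𝓞 K) =
      τ' μ / τ μ * w n ^ k := fun n => by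
    simp only [hw, map_mul, map_pow, div_pow]
    rw [mul_div_mul_comm]
  have hw1 : ∀ n, ‖w n‖ = 1 := fun n => by
    rw [hw, norm_div, hnorm, div_self]
    simp
  have hm1 : ‖τ' μ / τ μ‖ = 1 := by
    rw [norm_div, hnorm, div_self]
    simpa using hμ
  have hu0 : ∀ n, τ (μ * (ω n : 𝓞 K) ^ k : 𝓞 K) ≠ 0 := fun n => by
    simp [hμ]
  obtain ⟨hρ1, hρ, hev⟩ := eventually_norm_sub_mul_le hk2 hw1 hm1 hlim hH (c := φ₀ c) (B := B)
    fun n => by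
      rw [← norm_mul, sub_mul, ← hratio, div_mul_cancel₀ _ (hu0 n)]
      exact happ n
  set β : F := c * (i μ / i' μ) with hβ
  have hρβ : ρ ^ k = φ₀ β := by
    have h1 : τ μ ≠ 0 := by simpa using hμ
    have h2 : τ' μ ≠ 0 := by simpa using hμ
    rw [hβ, map_mul, map_div₀, hi_apply, hi'_apply, ← hρ]
    field_simp
  have hinv : ∀ n, (((ω n)⁻¹ : (𝓞 K)ˣ) : K) = ((ω n : 𝓞 K) : K)⁻¹ := fun n =>
    eq_inv_of_mul_eq_one_left (by rw [← map_mul, ← Units.val_mul]; simp)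
  set wF : ℕ → F := fun n => i' (ω n : 𝓞 K) * i (((ω n)⁻¹ : (𝓞 K)ˣ) : 𝓞 K) with hwF
  have hwinv : ∀ n, (wF n)⁻¹ = i (ω n : 𝓞 K) * i' (((ω n)⁻¹ : (𝓞 K)ˣ) : 𝓞 K) := fun n => by
    simp only [hwF, hinv, map_inv₀, mul_inv, inv_inv]
    ring
  have hφw : ∀ n, φ₀ (wF n) = w n := fun n => by
    simp only [hwF, hw, hinv, map_mul, map_inv₀, hi_apply, hi'_apply, div_eq_mul_inv]
  have hint : ∀ (x y : 𝓞 K) (j j' : K →+* F), IsIntegral ℤ (j x * j' y) := fun x y j j' =>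
    (x.isIntegral_coe.map j.toIntAlgHom).mul (y.isIntegral_coe.map j'.toIntAlgHom)
  set Z : ℕ → ℝ := fun n => H n ^ ((k : ℝ)⁻¹) with hZ
  have hZk : ∀ n, Z n ^ k = H n := fun n =>
    Real.rpow_inv_natCast_pow (norm_nonneg _) (by omega)
  have hZlim : Filter.Tendsto Z Filter.atTop Filter.atTop :=
    (tendsto_rpow_atTop (by positivity)).comp hH
  set A : ℝ := 1 + ∑ φ : K →+* ℂ, ‖φ μ‖⁻¹ with hA
  have hA0 : 1 ≤ A := le_add_of_nonneg_right (sum_nonneg fun _ _ => by positivity)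
  have hAφ : ∀ φ : K →+* ℂ, ‖φ μ‖⁻¹ ≤ A := fun φ =>
    (single_le_sum (f := fun φ : K →+* ℂ => ‖φ μ‖⁻¹) (fun _ _ => by positivity)
      (mem_univ φ)).trans (by linarith)
  have hωZ : ∀ n, A ≤ Z n → ∀ φ : K →+* ℂ, ‖φ (ω n : 𝓞 K)‖ ≤ Z n ^ 2 := by
    intro n hn φ
    have h1 : ‖φ (ω n : 𝓞 K)‖ ^ k ≤ (A * Z n) ^ k := by
      have h2 := hmax n φ
      have h3 : φ (μ * (ω n : 𝓞 K) ^ k : 𝓞 K) = φ μ * φ (ω n : 𝓞 K) ^ k := by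
        simp only [map_mul, map_pow]
      rw [h3, norm_mul, norm_pow] at h2
      have h4 : 0 < ‖φ μ‖ := by simpa using hμ
      have h5 : ‖φ (ω n : 𝓞 K)‖ ^ k ≤ ‖φ μ‖⁻¹ * H n := by
        rw [inv_mul_eq_div, le_div_iff₀' h4]
        exact h2
      rw [mul_pow, hZk]
      refine h5.trans ?_
      gcongr
      exact (hAφ φ).trans (le_self_pow₀ hA0 (by omega))
    have h2 := le_of_pow_le_pow_left₀ (by omega) (by nlinarith) h1
    nlinarith
  have hconj : ∀ n, A ≤ Z n → ∀ (j j' : K →+* F) (ψ : F →+* ℂ),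
      ‖ψ (j (ω n : 𝓞 K) * j' (((ω n)⁻¹ : (𝓞 K)ˣ) : 𝓞 K))‖ ≤ Z n ^ E := by
    intro n hn j j' ψ
    rw [hE, pow_mul]
    exact norm_mul_embedding_unit_inv_le (one_le_pow₀ (hA0.trans hn)) (hωZ n hn) j j' ψ
  have happrox : ∀ n, ‖w n - ρ‖ * H n ≤ B → B ≤ Z n → 0 < Z n →
      ‖w n - ρ‖ * Z n ^ (k - 1) ≤ 1 := by
    intro n hn hBn hn0
    have h1 : Z n ^ k = Z n ^ (k - 1) * Z n := by rw [← pow_succ]; congr 1; omega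
    rw [← hZk, h1, ← mul_assoc] at hn
    exact le_of_mul_le_mul_right (by linarith) hn0
  obtain ⟨z₀, hz₀⟩ := pow_eq_of_two_approximations φ₀ hE1 he hk hρβ hρ1
  filter_upwards [hev, hZlim.eventually_ge_atTop z₀, hZlim.eventually_ge_atTop A,
    hZlim.eventually_ge_atTop B] with n h1 h2 h3 h4
  obtain ⟨N, h5, h6, h7, h8⟩ := (hev.and ((hZlim.eventually_ge_atTop (Z n ^ (8 * e))).and
    ((hZlim.eventually_ge_atTop A).and (hZlim.eventually_ge_atTop B)))).exists
  have h := hz₀ (wF n) (wF N) (Z n) (Z N) h2 h6 (hwinv n ▸ hint _ _ _ _) (hint _ _ _ _)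
    (hwinv n ▸ hconj n h3 _ _) (hconj N h7 _ _) (by rw [hφw, hw1]) (by rw [hφw, hw1])
    (by rw [hφw]; exact happrox n h1 h4 (by linarith))
    (by rw [hφw]; exact happrox N h5 h8 (by linarith))
  rw [hratio, ← hρ, hρβ, ← hφw, ← map_pow, h]

theorem finite_conj_div_of_norm_sub_le {K F : Type*} [Field K] [NumberField K] [Field F]
    [NumberField F] (φ₀ : F →+* ℂ) (hF : ∀ τ : K →+* ℂ, ∃ i : K →+* F, φ₀.comp i = τ)
    (τ : K →+* ℂ) (c : F) {m : ℕ} (hm : m ≠ 0) (B : ℝ) :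
    {γ : ℂ | ∃ u : 𝓞 K, (Algebra.norm ℤ u).natAbs = m ∧ (∀ φ : K →+* ℂ, ‖φ u‖ ≤ ‖τ u‖) ∧
      ‖(starRingEnd ℂ) (τ u) - φ₀ c * τ u‖ ≤ B ∧ (starRingEnd ℂ) (τ u) / τ u = γ}.Finite := by
  obtain ⟨E, hE⟩ : ∃ E, E = 2 * (Module.finrank ℚ K + 1) := ⟨_, rfl⟩
  obtain ⟨e, he⟩ : ∃ e, e = E * Module.finrank ℚ F := ⟨_, rfl⟩
  obtain ⟨k, hk⟩ : ∃ k, k = 1000 * e ^ 2 := ⟨_, rfl⟩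
  have he1 : 1 ≤ e := by rw [he]; exact Nat.mul_pos (by omega) Module.finrank_pos
  obtain ⟨M, hM, hMu⟩ := exists_finite_norm_eq_mul_unit_pow K m
    (show k ≠ 0 by have := Nat.one_le_pow 2 e he1; omega)
  refine (hM.biUnion (t := fun μ => {γ : ℂ | μ ≠ 0 ∧ ∃ ω : (𝓞 K)ˣ,
    (∀ φ : K →+* ℂ, ‖φ (μ * (ω : 𝓞 K) ^ k : 𝓞 K)‖ ≤ ‖τ (μ * (ω : 𝓞 K) ^ k : 𝓞 K)‖) ∧
    ‖(starRingEnd ℂ) (τ (μ * (ω : 𝓞 K) ^ k : 𝓞 K)) - φ₀ c * τ (μ * (ω : 𝓞 K) ^ k : 𝓞 K)‖ ≤ B ∧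
    (starRingEnd ℂ) (τ (μ * (ω : 𝓞 K) ^ k : 𝓞 K)) / τ (μ * (ω : 𝓞 K) ^ k : 𝓞 K) = γ})
    fun μ _ => ?_).subset ?_
  · by_contra hinf
    let f := Set.Infinite.natEmbedding _ hinf
    have hμ : μ ≠ 0 := (f 0).2.1
    choose ω hmax happ hω using fun n => (f n).2.2
    have hinj : Function.Injective fun n => ((μ * (ω n : 𝓞 K) ^ k : 𝓞 K) : K) := by
      intro n n' h
      apply f.injective
      ext
      rw [← hω n, ← hω n']
      simp only at h
      rw [h]
    have hH : Filter.Tendsto (fun n => ‖τ (μ * (ω n : 𝓞 K) ^ k : 𝓞 K)‖) Filter.atTop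
        Filter.atTop := by
      rw [← Nat.cofinite_eq_atTop, Filter.tendsto_atTop]
      intro b
      rw [Filter.eventually_cofinite]
      refine ((Embeddings.finite_of_norm_le K ℂ b).preimage hinj.injOn).subset fun n hn => ?_
      exact ⟨(μ * (ω n : 𝓞 K) ^ k : 𝓞 K).isIntegral_coe,
        fun φ => (hmax n φ).trans (not_le.mp hn).le⟩
    obtain ⟨ρ, -, s, hs, hlim⟩ := (isCompact_sphere (0 : ℂ) 1).tendsto_subseq
      (x := fun n => (starRingEnd ℂ) (τ (ω n : 𝓞 K)) / τ (ω n : 𝓞 K)) fun n => by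
        rw [mem_sphere_zero_iff_norm, norm_div, Complex.norm_conj, div_self]
        simp
    have hev := eventually_conj_div_eq φ₀ hF τ c hE he hk hμ (ω := ω ∘ s) (fun n => hmax (s n))
      (fun n => happ (s n)) (hH.comp hs.tendsto_atTop) hlim
    obtain ⟨N, hN⟩ := Filter.eventually_atTop.mp hev
    have h := (hN N le_rfl).trans (hN (N + 1) (by omega)).symm
    simp only [Function.comp_apply, hω] at h
    have := hs.injective (f.injective (Subtype.ext h))
    omega
  · rintro γ ⟨u, hu, hmax, happ, hγ⟩
    obtain ⟨μ, hμ, ω, rfl⟩ := hMu u hu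
    refine Set.mem_biUnion hμ ⟨?_, ω, hmax, happ, hγ⟩
    rintro rfl
    apply hm
    rw [← hu]
    simp

theorem exists_norm_embedding_le {K : Type*} [Field K] [NumberField K] {u : K} {b : ℝ} (hb : 1 ≤ b)
    (h : |((Algebra.norm ℚ u : ℚ) : ℝ)| ≤ b) : ∃ σ : K →+* ℂ, ‖σ u‖ ≤ b := by
  by_contra! h0
  rw [← prod_norm_embeddings] at h
  have h1 : ∏ _φ : K →+* ℂ, b < ∏ φ : K →+* ℂ, ‖φ u‖ :=
    prod_lt_prod_of_nonempty (fun _ _ => by linarith) (fun φ _ => h0 φ) univ_nonempty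
  rw [prod_const] at h1
  have h2 : b ≤ b ^ #(univ : Finset (K →+* ℂ)) :=
    le_self_pow₀ hb (card_ne_zero.mpr univ_nonempty)
  linarith

theorem exists_finite_conj_div_mem_of_isIntegral {K : Type*} [Field K] [NumberField K]
    (htc : ∀ φ : K →+* ℂ, ¬ ComplexEmbedding.IsReal φ) {α : Fin 3 → K}
    (hα : ∀ i, IsIntegral ℤ (α i))
    (hgen : IntermediateField.adjoin ℚ {x : K | ∃ i j, x = α i / α j} = ⊤) {m : ℤ} (hm : m ≠ 0) :
    ∃ V : Set ℂ, V.Finite ∧ ∀ x : Fin 3 → ℤ, Algebra.norm ℚ (∑ i, (x i : K) * α i) = (m : ℚ) →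
      ∃ τ : K →+* ℂ, (starRingEnd ℂ) (τ (∑ i, (x i : K) * α i)) /
        τ (∑ i, (x i : K) * α i) ∈ V := by
  let F := IntermediateField.normalClosure ℚ K ℂ
  have : NumberField F := {}
  let φ₀ : F →+* ℂ := F.val
  have hmem : ∀ (τ : K →+* ℂ) (x : K), τ x ∈ F := fun τ x =>
    AlgHom.fieldRange_le_normalClosure τ.toRatAlgHom ⟨x, rfl⟩
  have hF : ∀ τ : K →+* ℂ, ∃ i : K →+* F, φ₀.comp i = τ := fun τ =>
    ⟨τ.codRestrict F (hmem τ), rfl⟩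
  have hL : ∀ (τ : K →+* ℂ) (x : K), τ x ∈ φ₀.fieldRange := fun τ x => ⟨⟨τ x, hmem τ x⟩, rfl⟩
  have hL' : ∀ (τ : K →+* ℂ) (x : K), (starRingEnd ℂ) (τ x) ∈ φ₀.fieldRange := fun τ x => by
    rw [← ComplexEmbedding.conjugate_coe_eq]
    exact hL _ x
  have key : ∀ σ τ : K →+* ℂ, ∃ c : F, ∃ B : ℝ, ∀ x : Fin 3 → ℤ,
      ‖σ (∑ i, (x i : K) * α i)‖ ≤ |(m : ℝ)| → ‖τ (∑ i, (x i : K) * α i)‖ ≤ B ∨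
        ‖(starRingEnd ℂ) (τ (∑ i, (x i : K) * α i)) - φ₀ c * τ (∑ i, (x i : K) * α i)‖ ≤ B := by
    intro σ τ
    obtain ⟨_, ⟨c, rfl⟩, B, h⟩ := exists_norm_conj_sub_mul_le (fun i => hL σ (α i))
      (fun i => hL' σ (α i)) (fun i => hL τ (α i)) (fun i => hL' τ (α i))
      (exists_mul_conjugate_ne hgen (htc σ)) |(m : ℝ)|
    refine ⟨c, B, fun x hx => ?_⟩
    have hsum : ∀ φ : K →+* ℂ, φ (∑ i, (x i : K) * α i) = ∑ i, ((x i : ℝ) : ℂ) * φ (α i) :=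
      fun φ => by simp
    rw [hsum] at hx ⊢
    exact h _ hx
  choose c B hcB using key
  refine ⟨⋃ (σ : K →+* ℂ) (τ : K →+* ℂ), ((fun u => (starRingEnd ℂ) (τ u) / τ u) ''
      {u | IsIntegral ℤ u ∧ ∀ φ : K →+* ℂ, ‖φ u‖ ≤ B σ τ}) ∪
    {γ : ℂ | ∃ u : 𝓞 K, (Algebra.norm ℤ u).natAbs = m.natAbs ∧ (∀ φ : K →+* ℂ, ‖φ u‖ ≤ ‖τ u‖) ∧
      ‖(starRingEnd ℂ) (τ u) - φ₀ (c σ τ) * τ u‖ ≤ B σ τ ∧ (starRingEnd ℂ) (τ u) / τ u = γ},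
    Set.finite_iUnion fun σ => Set.finite_iUnion fun τ =>
      ((Embeddings.finite_of_norm_le K ℂ _).image _).union
        (finite_conj_div_of_norm_sub_le φ₀ hF τ _ (Int.natAbs_ne_zero.mpr hm) _),
    fun x hx => ?_⟩
  set u := ∑ i, (x i : K) * α i with hu
  have hint : IsIntegral ℤ u := IsIntegral.sum _ fun i _ =>
    (show IsIntegral ℤ (x i : K) by
      simpa using isIntegral_algebraMap (R := ℤ) (A := K) (x := x i)).mul (hα i)
  obtain ⟨τ, -, hτ⟩ := exists_max_image (univ : Finset (K →+* ℂ)) (fun φ => ‖φ u‖) univ_nonempty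
  obtain ⟨σ, hσ⟩ := exists_norm_embedding_le (u := u) (b := |(m : ℝ)|)
    (by exact_mod_cast Int.one_le_abs hm) (by rw [hx, Rat.cast_intCast])
  refine ⟨τ, Set.mem_iUnion₂.mpr ⟨σ, τ, ?_⟩⟩
  rcases hcB σ τ x hσ with h | h
  · exact Or.inl ⟨u, ⟨hint, fun φ => (hτ φ (mem_univ φ)).trans h⟩, rfl⟩
  · refine Or.inr ⟨⟨u, hint⟩, ?_, fun φ => hτ φ (mem_univ φ), h, rfl⟩
    congr 1
    exact_mod_cast (Algebra.coe_norm_int (⟨u, hint⟩ : 𝓞 K)).trans hx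

theorem exists_finite_conj_div_mem {K : Type*} [Field K] [NumberField K]
    (htc : ∀ φ : K →+* ℂ, ¬ ComplexEmbedding.IsReal φ) {α : Fin 3 → K}
    (hgen : IntermediateField.adjoin ℚ {x : K | ∃ i j, x = α i / α j} = ⊤) {m : ℤ} (hm : m ≠ 0) :
    ∃ V : Set ℂ, V.Finite ∧ ∀ x : Fin 3 → ℤ, Algebra.norm ℚ (∑ i, (x i : K) * α i) = (m : ℚ) →
      ∃ τ : K →+* ℂ, (starRingEnd ℂ) (τ (∑ i, (x i : K) * α i)) /
        τ (∑ i, (x i : K) * α i) ∈ V := by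
  classical
  have : Algebra.IsAlgebraic ℤ K := IsFractionRing.comap_isAlgebraic_iff (K := ℚ).mpr inferInstance
  obtain ⟨b, hb, hint⟩ := Algebra.IsAlgebraic.exists_integral_multiples ℤ (univ.image α)
  have hbK : (b : K) ≠ 0 := by exact_mod_cast hb
  have hgen' : {x : K | ∃ i j, x = (b : K) * α i / ((b : K) * α j)} =
      {x : K | ∃ i j, x = α i / α j} := by
    simp only [mul_div_mul_left _ _ hbK]
  obtain ⟨V, hV, h⟩ := exists_finite_conj_div_mem_of_isIntegral htc (α := fun i => (b : K) * α i)
    (fun i => by simpa using hint (α i) (mem_image_of_mem α (mem_univ i)))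
    (by rw [hgen', hgen]) (m := b ^ Module.finrank ℚ K * m) (mul_ne_zero (pow_ne_zero _ hb) hm)
  refine ⟨V, hV, fun x hx => ?_⟩
  have hsum : ∑ i, (x i : K) * ((b : K) * α i) = (b : K) * ∑ i, (x i : K) * α i := by
    rw [mul_sum]
    exact sum_congr rfl fun i _ => by ring
  obtain ⟨τ, hτ⟩ := h x (by
    rw [hsum, map_mul, hx, ← eq_intCast (algebraMap ℤ K) b, IsScalarTower.algebraMap_apply ℤ ℚ K,
      Algebra.norm_algebraMap]
    simp)
  refine ⟨τ, ?_⟩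
  rw [hsum, map_mul, map_mul, map_intCast, map_intCast, mul_div_mul_left] at hτ
  · exact hτ
  · exact_mod_cast hb

end

/-- **Theorem 1 (norm-form equations in three variables over totally complex fields).**
Let `K` be a totally complex number field, `α₁, α₂, α₃ ∈ K` be `ℚ`-linearly independent
elements whose ratios `αⱼ/α_k` generate `K` over `ℚ`, and `m` a nonzero integer. Then
there exist an effective constant `C` and a finite set `S` of triples `(σ, τ, γ)` with
`σ ≠ τ` embeddings of `K` into `ℂ` and `γ ≠ 0`, such that every solution of
`N_{K/ℚ}(x₁α₁ + x₂α₂ + x₃α₃) = m` with `max|xᵢ| > C` satisfies `σ(u) = γ·τ(u)` for some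
`(σ, τ, γ) ∈ S`, where `u = x₁α₁ + x₂α₂ + x₃α₃`. -/
theorem normform_three_variables_effective
    (K : Type*) [Field K] [NumberField K]
    (htc : ∀ φ : K →+* ℂ, ¬ ComplexEmbedding.IsReal φ)
    (α : Fin 3 → K) (hli : LinearIndependent ℚ α)
    (hgen : IntermediateField.adjoin ℚ {x : K | ∃ i j, x = α i / α j} = ⊤)
    (m : ℤ) (hm : m ≠ 0) :
    ∃ (C : ℝ) (S : Set ((K →+* ℂ) × (K →+* ℂ) × ℂ)), S.Finite ∧
      (∀ p ∈ S, p.1 ≠ p.2.1 ∧ p.2.2 ≠ 0) ∧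
      ∀ x : Fin 3 → ℤ,
        Algebra.norm ℚ (∑ i, (x i : K) * α i) = (m : ℚ) →
        C < ((Finset.univ.sup fun i => (x i).natAbs : ℕ) : ℝ) →
        ∃ p ∈ S, p.1 (∑ i, (x i : K) * α i) = p.2.2 * p.2.1 (∑ i, (x i : K) * α i) := by
  obtain ⟨V, hV, h⟩ := exists_finite_conj_div_mem htc hgen hm
  refine ⟨0, (fun q : (K →+* ℂ) × ℂ => (ComplexEmbedding.conjugate q.1, q.1, q.2)) ''
    (Set.univ ×ˢ (V \ {0})), (Set.finite_univ.prod (hV.subset Set.sdiff_subset)).image _, ?_,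
    fun x hx _ => ?_⟩
  · rintro _ ⟨⟨τ, γ⟩, ⟨-, -, hγ⟩, rfl⟩
    exact ⟨fun hτ => htc τ hτ, hγ⟩
  · obtain ⟨τ, hτ⟩ := h x hx
    have hu : τ (∑ i, (x i : K) * α i) ≠ 0 := by
      intro h0
      rw [map_eq_zero] at h0
      rw [h0, Algebra.norm_zero] at hx
      exact hm (by exact_mod_cast hx.symm)
    refine ⟨_, ⟨(τ, _), ⟨trivial, hτ, ?_⟩, rfl⟩, ?_⟩
    · exact div_ne_zero ((map_ne_zero _).mpr hu) hu
    · rw [div_mul_cancel₀ _ hu, ComplexEmbedding.conjugate_coe_eq]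
end
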